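/- arXiv:0910.1380 — 3 statements merged into one kernel-verified Lean document; each statement's English description precedes it below -/
import Mathlib

section
/- Let n ≥ 1 be odd. For F ∈ 𝒮(ℝⁿ × ℝ), the inversion formula F = π^{−n} (P* ∘ Λ_y ∘ P)(F) holds, where P(F)(x,y) = ∫_{ℝⁿ} F(x+u, y−|u|²) du, P*(G)(x,y) = ∫_{ℝⁿ} G(x+u, y+|u|²) du, and Λ_y = (−1)^{(n−1)/2} H_y ∘ ∂_y^n with H_y the Hilbert transform in the y-variable: H_y(φ)(x,y) = (1/π) p.v. ∫ φ(x,t)/(y−t) dt. -/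
open MeasureTheory Filter

section Hilbert
open scoped FourierTransform SchwartzMap Topology
open Real Set

lemma integral_sym {f : ℝ → ℂ} (hf : Integrable f) :
    ∫ t, f t = ∫ t in Ioi (0:ℝ), (f t + f (-t)) := by
  rw [integral_add hf.integrableOn hf.comp_neg.integrableOn, integral_comp_neg_Ioi 0 f, neg_zero,
    ← intervalIntegral.integral_Iic_add_Ioi hf.integrableOn hf.integrableOn, add_comm]

lemma integrableOn_Q (ψ : 𝓢(ℝ, ℂ)) :
    IntegrableOn (fun t : ℝ => (ψ t - ψ (-t)) / (t:ℂ)) (Ioi 0) := by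
  obtain ⟨C, hC⟩ : ∃ C, ∀ x, ‖deriv ψ x‖ ≤ C := by
    refine ⟨SchwartzMap.seminorm ℝ 0 1 ψ, fun x => ?_⟩
    have := SchwartzMap.le_seminorm' ℝ 0 1 ψ x
    simpa using this
  have hb : Integrable ((Ioc (0:ℝ) 1).indicator (fun _ => C * 2)) := by
    rw [integrable_indicator_iff measurableSet_Ioc]
    exact integrableOn_const (by simp)
  have hint : Integrable (fun t : ℝ => (Ioc (0:ℝ) 1).indicator (fun _ => C * 2) t + (‖ψ t‖ + ‖ψ (-t)‖)) :=
    hb.add (ψ.integrable.norm.add ψ.integrable.comp_neg.norm)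
  refine Integrable.mono' hint.integrableOn ?_ ?_
  · apply Measurable.aestronglyMeasurable
    have := ψ.continuous.measurable
    fun_prop
  · rw [ae_restrict_iff' measurableSet_Ioi]
    refine Eventually.of_forall fun t ht => ?_
    have ht : 0 < t := ht
    rw [norm_div, Complex.norm_real, Real.norm_of_nonneg ht.le, div_le_iff₀ ht]
    by_cases h1 : t ≤ 1
    · rw [indicator_of_mem (show t ∈ Ioc (0:ℝ) 1 from ⟨ht, h1⟩)]
      have := Convex.norm_image_sub_le_of_norm_deriv_le (f := ψ) (s := univ) (C := C) (x := -t) (y := t)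
        (fun x _ => ψ.differentiableAt) (fun x _ => hC x) convex_univ (mem_univ _) (mem_univ _)
      have e : ‖t - -t‖ = 2 * t := by
        rw [Real.norm_of_nonneg (by linarith)]; ring
      rw [e] at this
      have : 0 ≤ (‖ψ t‖ + ‖ψ (-t)‖) * t := by positivity
      nlinarith
    · rw [indicator_of_notMem (by simp; intro _; linarith)]
      have := norm_sub_le (ψ t) (ψ (-t))
      have : 0 ≤ ‖ψ t‖ + ‖ψ (-t)‖ := by positivity
      nlinarith

lemma tendsto_pv (ψ : 𝓢(ℝ, ℂ)) :
    Tendsto (fun ε : ℝ => ∫ t in {t : ℝ | ε < |t|}, ψ t / (t:ℂ)) (𝓝[>] 0)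
      (𝓝 (∫ t in Ioi (0:ℝ), (ψ t - ψ (-t)) / (t:ℂ))) := by
  have h1 : Tendsto (fun ε : ℝ => ∫ t in Ioi (0:ℝ),
      (Ioi ε).indicator (fun t : ℝ => (ψ t - ψ (-t)) / (t:ℂ)) t) (𝓝[>] 0)
      (𝓝 (∫ t in Ioi (0:ℝ), (ψ t - ψ (-t)) / (t:ℂ))) := by
    apply tendsto_integral_filter_of_dominated_convergence
      (fun t => ‖(ψ t - ψ (-t)) / (t:ℂ)‖)
    · exact Eventually.of_forall fun ε => (integrableOn_Q ψ).1.indicator measurableSet_Ioi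
    · exact Eventually.of_forall fun ε => Eventually.of_forall fun t => norm_indicator_le_norm_self _ _
    · exact (integrableOn_Q ψ).norm
    · rw [ae_restrict_iff' measurableSet_Ioi]
      refine Eventually.of_forall fun t ht => ?_
      apply tendsto_const_nhds.congr'
      have : ∀ᶠ ε in 𝓝[>] (0:ℝ), ε < t := nhdsWithin_le_nhds (Iio_mem_nhds ht)
      filter_upwards [this] with ε hε
      rw [indicator_of_mem (show t ∈ Ioi ε from hε)]
  refine h1.congr' ?_
  filter_upwards [self_mem_nhdsWithin] with ε hε
  have hε : 0 < ε := hε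
  have hm : MeasurableSet {t : ℝ | ε < |t|} := measurableSet_lt measurable_const (by fun_prop)
  rw [← integral_indicator hm, integral_sym]
  · apply setIntegral_congr_fun measurableSet_Ioi
    intro t ht
    have ht : 0 < t := ht
    beta_reduce
    by_cases h : ε < t
    · rw [indicator_of_mem (show t ∈ Ioi ε from h),
        indicator_of_mem (show t ∈ {t : ℝ | ε < |t|} by simpa [abs_of_pos ht] using h),
        indicator_of_mem (show -t ∈ {t : ℝ | ε < |t|} by simpa [abs_of_pos ht] using h)]
      push_cast
      rw [div_neg, sub_div, sub_eq_add_neg]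
    · rw [indicator_of_notMem (show t ∉ Ioi ε from h),
        indicator_of_notMem (show t ∉ {t : ℝ | ε < |t|} by simpa [abs_of_pos ht] using h),
        indicator_of_notMem (show -t ∉ {t : ℝ | ε < |t|} by simpa [abs_of_pos ht] using h)]
      simp
  · rw [integrable_indicator_iff hm]
    refine Integrable.mono' ((ψ.integrable (μ := volume)).norm.const_mul (ε⁻¹)).integrableOn ?_ ?_
    · apply Measurable.aestronglyMeasurable
      have := ψ.continuous.measurable
      fun_prop
    · rw [ae_restrict_iff' hm]
      refine Eventually.of_forall fun t ht => ?_
      have ht : ε < |t| := ht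
      rw [norm_div, Complex.norm_real, Real.norm_eq_abs, div_eq_inv_mul]
      gcongr

/-- the regularised sign -/
noncomputable def sreg (a : ℝ) (s : ℝ) : ℂ := ((SignType.sign s : ℝ) : ℂ) * Complex.exp ((-(2 * π * a * |s|) : ℝ))

lemma measurable_sgn : Measurable (fun s : ℝ => (SignType.sign s : ℝ)) := by
  have : (fun s : ℝ => (SignType.sign s : ℝ)) = fun s => if 0 < s then 1 else if s < 0 then -1 else 0 := by
    ext s
    rcases lt_trichotomy s 0 with h | h | h
    · simp [h, not_lt.2 h.le]
    · simp [h]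
    · simp [h]
  rw [this]
  exact Measurable.ite measurableSet_Ioi measurable_const
    (Measurable.ite measurableSet_Iio measurable_const measurable_const)

lemma norm_sgn_le (s : ℝ) : ‖((SignType.sign s : ℝ) : ℂ)‖ ≤ 1 := by
  rcases lt_trichotomy s 0 with h | h | h <;> simp [h]

lemma norm_sreg_le (a s : ℝ) : ‖sreg a s‖ ≤ rexp (-(2 * π * a * |s|)) := by
  rw [sreg, norm_mul, Complex.norm_exp, Complex.ofReal_re]
  have := norm_sgn_le s
  have := Real.exp_pos (-(2 * π * a * |s|))
  nlinarith

lemma measurable_sreg (a : ℝ) : Measurable (sreg a) := by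
  unfold sreg
  have := measurable_sgn
  fun_prop

lemma integrable_sreg {a : ℝ} (ha : 0 < a) : Integrable (sreg a) := by
  have h : Integrable (fun s : ℝ => rexp (-(2 * π * a * |s|))) := by
    have hpos : 0 < 2 * π * a := by have := Real.pi_pos; positivity
    have h1 : IntegrableOn (fun s : ℝ => rexp (-(2 * π * a * |s|))) (Ioi 0) := by
      refine (integrableOn_congr_fun (f := fun s : ℝ => rexp (-(2 * π * a) * s)) ?_ measurableSet_Ioi).1
        (exp_neg_integrableOn_Ioi 0 hpos)
      intro s hs
      simp [abs_of_pos (show 0 < s from hs)]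
    have h2 : IntegrableOn (fun s : ℝ => rexp (-(2 * π * a * |s|))) (Iic 0) := by
      rw [integrableOn_Iic_iff_integrableOn_Iio]
      rw [← neg_zero] at h1
      simpa using h1.comp_neg_Iio
    have := h2.union h1
    rwa [Iic_union_Ioi, integrableOn_univ] at this
  exact h.mono' (measurable_sreg a).aestronglyMeasurable (Eventually.of_forall fun s => norm_sreg_le a s)

lemma fourier_sreg {a : ℝ} (ha : 0 < a) (t : ℝ) :
    𝓕 (sreg a) t = -(Complex.I / π) * ((t / (a ^ 2 + t ^ 2) : ℝ) : ℂ) := by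
  have hpi := Real.pi_pos
  rw [Real.fourier_real_eq_integral_exp_smul, integral_sym]
  swap
  · refine (integrable_sreg ha).mono (Measurable.aestronglyMeasurable
      (by have := measurable_sreg a; fun_prop)) (Eventually.of_forall fun s => ?_)
    rw [norm_smul, Complex.norm_exp_ofReal_mul_I, one_mul]
  set b : ℂ := -(2 * π) * (a + t * Complex.I) with hb
  set c : ℂ := -(2 * π) * (a - t * Complex.I) with hc
  have hbr : b.re < 0 := by simp [hb]; positivity
  have hcr : c.re < 0 := by simp [hc]; positivity
  have key : ∀ s ∈ Ioi (0:ℝ), Complex.exp (((-2 * π * s * t : ℝ):ℂ) * Complex.I) • sreg a s +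
      Complex.exp (((-2 * π * (-s) * t : ℝ):ℂ) * Complex.I) • sreg a (-s) =
      Complex.exp (b * s) - Complex.exp (c * s) := by
    intro s hs
    have hs : 0 < s := hs
    simp only [sreg, smul_eq_mul, abs_neg, abs_of_pos hs, sign_pos hs, Left.sign_neg, hb, hc]
    simp only [SignType.coe_one, SignType.coe_neg, Complex.ofReal_one, Complex.ofReal_neg, one_mul, neg_mul, mul_neg, ← Complex.exp_add, sub_eq_add_neg]
    push_cast
    congr 2
    · ring_nf
    · ring_nf
  rw [setIntegral_congr_fun measurableSet_Ioi key, integral_sub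
    (integrableOn_exp_mul_complex_Ioi hbr 0) (integrableOn_exp_mul_complex_Ioi hcr 0),
    integral_exp_mul_complex_Ioi hbr, integral_exp_mul_complex_Ioi hcr]
  have h1 : (a:ℂ) + t * Complex.I ≠ 0 := by
    intro h; have := congrArg Complex.re h; simp at this; linarith
  have h2 : (a:ℂ) - t * Complex.I ≠ 0 := by
    intro h; have := congrArg Complex.re h; simp at this; linarith
  have h3 : (a:ℂ)^2 + t^2 = (a + t * Complex.I) * (a - t * Complex.I) := by
    ring_nf; simp
  have hpc : (π:ℂ) ≠ 0 := by exact_mod_cast hpi.ne'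
  push_cast
  rw [h3, hb, hc]
  simp only [mul_zero, Complex.exp_zero]
  field_simp
  ring_nf

lemma hilbert_identity (ψ : 𝓢(ℝ, ℂ)) :
    ∫ t in Ioi (0:ℝ), (ψ t - ψ (-t)) / (t:ℂ) =
      Complex.I * π * ∫ s : ℝ, ((SignType.sign s : ℝ) : ℂ) * 𝓕 ψ s := by
  have hpi := Real.pi_pos
  have hpc : (π:ℂ) ≠ 0 := by exact_mod_cast hpi.ne'
  have hid : ∀ a : ℝ, 0 < a → ∫ s : ℝ, sreg a s * 𝓕 ψ s =
      -(Complex.I / π) * ∫ t in Ioi (0:ℝ), ((t^2 / (a ^ 2 + t ^ 2) : ℝ) : ℂ) * ((ψ t - ψ (-t)) / (t:ℂ)) := by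
    intro a ha
    have h := VectorFourier.integral_fourierIntegral_smul_eq_flip (L := innerₗ ℝ) (μ := volume) (ν := volume) (e := Real.fourierChar) (f := sreg a) (g := ψ)
      Real.continuous_fourierChar continuous_inner (integrable_sreg ha) ψ.integrable
    have h' : ∫ t, 𝓕 (sreg a) t * ψ t = ∫ s, sreg a s * 𝓕 ψ s := by
      simpa using! h
    rw [← h']
    have hK : ∀ t : ℝ, |t / (a^2 + t^2)| ≤ 1 / (2*a) := by
      intro t
      rw [abs_div, abs_of_pos (show 0 < a^2+t^2 by positivity), div_le_div_iff₀ (by positivity) (by positivity)]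
      nlinarith [sq_nonneg (a - |t|), sq_abs t]
    rw [integral_sym, ← integral_const_mul]
    · apply setIntegral_congr_fun measurableSet_Ioi
      intro t ht
      have ht : (t:ℂ) ≠ 0 := by exact_mod_cast (ne_of_gt ht)
      have : (a:ℂ)^2 + t^2 ≠ 0 := by
        have : 0 < a^2+t^2 := by positivity
        exact_mod_cast this.ne'
      simp only [fourier_sreg ha]
      push_cast
      rw [neg_sq]
      field_simp
      ring
    · refine Integrable.mono' ((ψ.integrable (μ := volume)).norm.const_mul (1 / π * (1 / (2*a)))) ?_ ?_
      · simp only [fourier_sreg ha]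
        apply Measurable.aestronglyMeasurable
        have := ψ.continuous.measurable
        fun_prop
      · refine Eventually.of_forall fun t => ?_
        rw [norm_mul, fourier_sreg ha, norm_mul, Complex.norm_real, Real.norm_eq_abs]
        have e : ‖-(Complex.I / (π:ℂ))‖ = 1 / π := by simp [abs_of_pos hpi]
        rw [e]
        gcongr
        exact hK t
  have hL : Tendsto (fun a : ℝ => ∫ s : ℝ, sreg a s * 𝓕 ψ s) (𝓝[>] 0)
      (𝓝 (∫ s : ℝ, ((SignType.sign s : ℝ) : ℂ) * 𝓕 ψ s)) := by
    apply tendsto_integral_filter_of_dominated_convergence (fun s => ‖𝓕 ψ s‖)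
    · exact Eventually.of_forall fun a => ((measurable_sreg a).mul (𝓕 ψ).continuous.measurable).aestronglyMeasurable
    · filter_upwards [self_mem_nhdsWithin] with a ha
      have ha : 0 < a := ha
      refine Eventually.of_forall fun s => ?_
      rw [norm_mul]
      have h1 := norm_sreg_le a s
      have h2 : rexp (-(2 * π * a * |s|)) ≤ 1 := by
        rw [Real.exp_le_one_iff]
        have : 0 ≤ 2 * π * a * |s| := by positivity
        linarith
      have := norm_nonneg (𝓕 ψ s)
      nlinarith
    · exact (𝓕 ψ).integrable.norm
    · refine Eventually.of_forall fun s => ?_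
      apply Tendsto.mul_const
      have : Continuous (fun a => sreg a s) := by unfold sreg; fun_prop
      have h := (this.tendsto 0).mono_left (nhdsWithin_le_nhds (s := Ioi 0))
      simpa [sreg] using h
  have hR : Tendsto (fun a : ℝ => ∫ t in Ioi (0:ℝ), ((t^2 / (a ^ 2 + t ^ 2) : ℝ) : ℂ) * ((ψ t - ψ (-t)) / (t:ℂ))) (𝓝[>] 0)
      (𝓝 (∫ t in Ioi (0:ℝ), (ψ t - ψ (-t)) / (t:ℂ))) := by
    apply tendsto_integral_filter_of_dominated_convergence
      (fun t => ‖(ψ t - ψ (-t)) / (t:ℂ)‖)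
    · refine Eventually.of_forall fun a => ?_
      apply Measurable.aestronglyMeasurable
      have := ψ.continuous.measurable
      fun_prop
    · refine Eventually.of_forall fun a => Eventually.of_forall fun t => ?_
      rw [norm_mul, Complex.norm_real, Real.norm_of_nonneg (by positivity)]
      have : t^2 / (a^2+t^2) ≤ 1 := div_le_one_of_le₀ (by nlinarith [sq_nonneg a]) (by positivity)
      exact mul_le_of_le_one_left (norm_nonneg _) this
    · exact (integrableOn_Q ψ).norm
    · rw [ae_restrict_iff' measurableSet_Ioi]
      refine Eventually.of_forall fun t ht => ?_
      have ht : 0 < t := ht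
      have h1 : ContinuousAt (fun a : ℝ => t^2/(a^2+t^2)) 0 := by
        apply ContinuousAt.div (by fun_prop) (by fun_prop)
        positivity
      have h2 : Tendsto (fun a : ℝ => t^2/(a^2+t^2)) (𝓝[>] 0) (𝓝 1) := by
        have := h1.tendsto.mono_left (nhdsWithin_le_nhds (s := Ioi 0))
        have e : t^2/((0:ℝ)^2+t^2) = 1 := by field_simp; simp
        rwa [e] at this
      have h3 := (Complex.continuous_ofReal.tendsto 1).comp h2
      simpa using h3.mul_const ((ψ t - ψ (-t)) / (t:ℂ))
  have h1 := hL.congr' (by filter_upwards [self_mem_nhdsWithin] with a ha using hid a ha)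
  have h2 := tendsto_nhds_unique h1 (hR.const_mul _)
  rw [h2]
  field_simp
  simp

end Hilbert

section Radon
open scoped FourierTransform SchwartzMap Topology
open Real Set

variable {E : Type*} [NormedAddCommGroup E] [InnerProductSpace ℝ E]

set_option linter.unusedSectionVars false in
lemma norm_withLp_le (v : WithLp 2 (E × ℝ)) : ‖v‖ ≤ ‖v.fst‖ + ‖v.snd‖ := by
  rw [WithLp.prod_norm_eq_of_L2]
  apply Real.sqrt_le_iff.2
  constructor
  · positivity
  · nlinarith [mul_nonneg (norm_nonneg v.fst) (norm_nonneg v.snd)]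

lemma exists_lift (F : 𝓢(E × ℝ, ℝ)) (x : E) (y : ℝ) :
    ∃ g : 𝓢(WithLp 2 (E × ℝ), ℂ), ∀ w t, g (WithLp.toLp 2 (w, t)) = F (x + w, y + t - ‖w‖ ^ 2) := by
  let γ : WithLp 2 (E × ℝ) → E × ℝ := fun v =>
    ContinuousLinearMap.inl ℝ E ℝ (x + WithLp.fstL 2 ℝ E ℝ v) +
      ContinuousLinearMap.inr ℝ E ℝ (y + WithLp.sndL 2 ℝ E ℝ v - ‖WithLp.fstL 2 ℝ E ℝ v‖ ^ 2)
  have hn : Function.HasTemperateGrowth (fun v : WithLp 2 (E × ℝ) => ‖WithLp.fstL 2 ℝ E ℝ v‖ ^ 2) :=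
    (Function.hasTemperateGrowth_norm_sq E).comp (WithLp.fstL 2 ℝ E ℝ).hasTemperateGrowth
  have hγ : γ.HasTemperateGrowth := by
    apply Function.HasTemperateGrowth.add
    · exact (ContinuousLinearMap.hasTemperateGrowth _).comp
        ((Function.HasTemperateGrowth.const x).add (WithLp.fstL 2 ℝ E ℝ).hasTemperateGrowth)
    · exact (ContinuousLinearMap.hasTemperateGrowth _).comp
        (((Function.HasTemperateGrowth.const y).add (WithLp.sndL 2 ℝ E ℝ).hasTemperateGrowth).sub hn)
  have hγe : ∀ v, γ v = (x + v.fst, y + v.snd - ‖v.fst‖^2) := by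
    intro v
    ext <;> simp [γ]
  have hup : ∃ (k : ℕ) (C : ℝ), ∀ v, ‖v‖ ≤ C * (1 + ‖γ v‖) ^ k := by
    refine ⟨2, 3 * (1 + ‖x‖ + ‖y‖)^2, fun v => ?_⟩
    set m := ‖γ v‖ with hm
    have h1 : ‖v.fst‖ ≤ m + ‖x‖ := by
      have : ‖x + v.fst‖ ≤ m := by rw [hm, hγe]; exact norm_fst_le (x + v.fst, y + v.snd - ‖v.fst‖^2)
      have h2 : v.fst = (x + v.fst) - x := by abel
      rw [h2]
      exact (norm_sub_le _ _).trans (by linarith)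
    have h2 : ‖v.snd‖ ≤ m + ‖y‖ + ‖v.fst‖^2 := by
      have : ‖y + v.snd - ‖v.fst‖^2‖ ≤ m := by rw [hm, hγe]; exact norm_snd_le (x + v.fst, y + v.snd - ‖v.fst‖^2)
      simp only [Real.norm_eq_abs] at this ⊢
      rcases abs_cases (y + v.snd - ‖v.fst‖^2) with h | h <;> rcases abs_cases (v.snd) with h' | h' <;> rcases abs_cases y with h'' | h'' <;> nlinarith [sq_nonneg ‖v.fst‖]
    have h0 : 0 ≤ m := norm_nonneg _
    have hx := norm_nonneg x
    have hy := norm_nonneg y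
    have hv := norm_nonneg v.fst
    set A := 1 + ‖x‖ + ‖y‖
    have h3 : ‖v.fst‖ ≤ A * (1 + m) := by nlinarith
    have h4 : m + ‖y‖ ≤ A * (1 + m) := by nlinarith
    have h5 : 1 ≤ A * (1 + m) := by nlinarith
    have := norm_withLp_le v
    rw [mul_assoc, ← mul_pow]
    nlinarith
  refine ⟨(SchwartzMap.compCLM ℝ hγ hup F).postcompCLM Complex.ofRealCLM, fun w t => ?_⟩
  rw [SchwartzMap.postcompCLM_apply, SchwartzMap.compCLM_apply, Function.comp_apply, hγe]
  simp

lemma exists_line (f : 𝓢(WithLp 2 (E × ℝ), ℂ)) (u : E) :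
    ∃ φ : 𝓢(ℝ, ℂ), ∀ s : ℝ, φ s = f (WithLp.toLp 2 ((-2 * s) • u, s)) := by
  let L : ℝ →L[ℝ] WithLp 2 (E × ℝ) := ContinuousLinearMap.toSpanSingleton ℝ (WithLp.toLp 2 ((-2:ℝ) • u, (1:ℝ)))
  have hL : ∀ s, L s = WithLp.toLp 2 ((-2 * s) • u, s) := by
    intro s
    simp only [L, ContinuousLinearMap.toSpanSingleton_apply, ← WithLp.toLp_smul]
    simp [smul_smul, mul_comm]
  refine ⟨SchwartzMap.compCLM ℝ L.hasTemperateGrowth ⟨1, 1, fun s => ?_⟩ f, fun s => ?_⟩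
  · have := WithLp.norm_snd_le (p := 2) _ (L s)
    rw [hL] at this
    rw [hL]
    simp only [WithLp.toLp_snd] at this
    linarith
  · rw [SchwartzMap.compCLM_apply, Function.comp_apply, hL]

lemma exists_shear (f : 𝓢(WithLp 2 (E × ℝ), ℂ)) (u : E) :
    ∃ k : 𝓢(E × ℝ, ℂ), ∀ w t, k (w, t) = f (WithLp.toLp 2 (w, t + 2 * inner ℝ w u)) := by
  let L : E × ℝ →L[ℝ] WithLp 2 (E × ℝ) := ((WithLp.prodContinuousLinearEquiv 2 ℝ E ℝ).symm : E × ℝ →L[ℝ] _) ∘L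
    ((ContinuousLinearMap.fst ℝ E ℝ).prod (ContinuousLinearMap.snd ℝ E ℝ + (2:ℝ) • (innerSL ℝ u) ∘L (ContinuousLinearMap.fst ℝ E ℝ)))
  have hL : ∀ w t, L (w, t) = WithLp.toLp 2 (w, t + 2 * inner ℝ w u) := by
    intro w t
    simp [L, real_inner_comm]
  refine ⟨SchwartzMap.compCLM ℝ L.hasTemperateGrowth ⟨1, 1 + 2 * ‖u‖, fun p => ?_⟩ f, fun w t => ?_⟩
  · obtain ⟨w, t⟩ := p
    have h1 := WithLp.norm_fst_le (p := 2) _ (L (w, t))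
    have h2 := WithLp.norm_snd_le (p := 2) _ (L (w, t))
    rw [hL] at h1 h2 ⊢
    set M := ‖WithLp.toLp 2 (w, t + 2 * inner ℝ w u)‖
    simp only [WithLp.toLp_snd, WithLp.toLp_fst] at h1 h2
    have h3 := abs_real_inner_le_norm w u
    have hu := norm_nonneg u
    have hw := norm_nonneg w
    have h4 : |t| ≤ M + 2 * (‖w‖ * ‖u‖) := by
      rw [Real.norm_eq_abs, abs_le] at h2
      rw [abs_le] at *
      constructor <;> linarith [h2.1, h2.2, h3.1, h3.2]
    have h5 : ‖w‖ * ‖u‖ ≤ M * ‖u‖ := by gcongr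
    have h6 : 0 ≤ M := norm_nonneg _
    rw [Prod.norm_mk, Real.norm_eq_abs]
    apply max_le <;> nlinarith
  · rw [SchwartzMap.compCLM_apply, Function.comp_apply, hL]

variable [MeasurableSpace E] [BorelSpace E] [FiniteDimensional ℝ E]

lemma continuous_fiber (k : 𝓢(E × ℝ, ℂ)) : Continuous (fun t : ℝ => ∫ w : E, k (w, t)) := by
  set N := Module.finrank ℝ E + 1
  set C := 2 ^ N * (Finset.Iic (N, 0)).sup (fun m => SchwartzMap.seminorm ℝ m.1 m.2) k
  have hb : ∀ w t, ‖k (w, t)‖ ≤ C * (1 + ‖w‖) ^ (-(N:ℝ)) := by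
    intro w t
    have h := SchwartzMap.one_add_le_sup_seminorm_apply (𝕜 := ℝ) (m := (N, 0)) (k := N) (n := 0) le_rfl le_rfl k (w, t)
    rw [norm_iteratedFDeriv_zero] at h
    rw [Real.rpow_neg (by positivity), ← div_eq_mul_inv, le_div_iff₀ (by positivity), Real.rpow_natCast, mul_comm]
    refine le_trans ?_ h
    gcongr
    exact norm_fst_le (w, t)
  apply continuous_of_dominated (bound := fun w => C * (1 + ‖w‖) ^ (-(N:ℝ)))
  · intro t
    exact (k.continuous.comp (by fun_prop)).aestronglyMeasurable
  · exact fun t => Eventually.of_forall fun w => hb w t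
  · exact (integrable_one_add_norm (by simp [N])).const_mul _
  · exact Eventually.of_forall fun w => k.continuous.comp (by fun_prop)

lemma integrable_fiber (k : 𝓢(E × ℝ, ℂ)) : Integrable (fun t : ℝ => ∫ w : E, k (w, t)) := by
  have : Integrable (k : E × ℝ → ℂ) ((volume : Measure E).prod (volume : Measure ℝ)) := k.integrable
  exact this.integral_prod_right

lemma fourier_fiber (g : 𝓢(WithLp 2 (E × ℝ), ℂ)) (u : E) (s : ℝ) :
    𝓕 (fun t : ℝ => ∫ w : E, g (WithLp.toLp 2 (w, t + 2 * inner ℝ w u))) s =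
      𝓕 g (WithLp.toLp 2 ((-2 * s) • u, s)) := by
  obtain ⟨k, hk⟩ := exists_shear g u
  have hki : Integrable (k : E × ℝ → ℂ) ((volume : Measure E).prod (volume : Measure ℝ)) := k.integrable
  simp_rw [← hk]
  rw [Real.fourier_real_eq_integral_exp_smul, SchwartzMap.fourier_coe, Real.fourier_eq']
  simp_rw [smul_eq_mul, ← integral_const_mul]
  have hint : Integrable (Function.uncurry fun (w : E) (t : ℝ) => Complex.exp (((-2 * π * t * s : ℝ) : ℂ) * Complex.I) * k (w, t))
      ((volume : Measure E).prod (volume : Measure ℝ)) := by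
    refine hki.mono ?_ (Eventually.of_forall fun p => ?_)
    · apply Continuous.aestronglyMeasurable
      have := k.continuous
      unfold Function.uncurry
      fun_prop
    · simp only [Function.uncurry, norm_mul, Complex.norm_exp_ofReal_mul_I, one_mul, le_refl]
  rw [← integral_integral_swap hint]
  have e1 : ∀ w : E, ∫ t : ℝ, Complex.exp (((-2 * π * t * s : ℝ) : ℂ) * Complex.I) * k (w, t) =
      ∫ t : ℝ, Complex.exp (((-2 * π * (t - 2 * inner ℝ w u) * s : ℝ) : ℂ) * Complex.I) * g (WithLp.toLp 2 (w, t)) := by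
    intro w
    rw [← integral_add_right_eq_self (fun t : ℝ => Complex.exp (((-2 * π * (t - 2 * inner ℝ w u) * s : ℝ) : ℂ) * Complex.I) * g (WithLp.toLp 2 (w, t))) (2 * inner ℝ w u)]
    congr 1
    ext t
    rw [hk, add_sub_cancel_right]
  simp_rw [e1]
  have hmp := WithLp.volume_preserving_toLp E ℝ
  have hemb : MeasurableEmbedding (@WithLp.toLp 2 (E × ℝ)) := (MeasurableEquiv.toLp 2 (E × ℝ)).measurableEmbedding
  rw [← hmp.integral_comp hemb, Measure.volume_eq_prod, integral_prod]
  · congr 1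
    ext w
    congr 1
    ext t
    simp only [WithLp.prod_inner_apply, inner_smul_right]
    congr 4
    simp
    ring
  · have : Integrable (fun v => Complex.exp (((-2 * π * inner ℝ v (WithLp.toLp 2 ((-2 * s) • u, s)) : ℝ) : ℂ) * Complex.I) * g v) := by
      refine g.integrable.mono ?_ (Eventually.of_forall fun p => ?_)
      · apply Continuous.aestronglyMeasurable
        have := g.continuous
        fun_prop
      · rw [norm_mul, Complex.norm_exp_ofReal_mul_I, one_mul]
    exact (hmp.integrable_comp_emb hemb).2 this

lemma radon_integral (f : 𝓢(WithLp 2 (E × ℝ), ℂ)) (n : ℕ) (hn : Module.finrank ℝ E = n) :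
    ∫ u : E, ∫ s : ℝ, ((|s| ^ n : ℝ) : ℂ) * f (WithLp.toLp 2 ((-2 * s) • u, s)) =
      ((2:ℂ) ^ n)⁻¹ * ∫ v, f v := by
  have hmp := WithLp.volume_preserving_toLp E ℝ
  have hemb : MeasurableEmbedding (@WithLp.toLp 2 (E × ℝ)) := (MeasurableEquiv.toLp 2 (E × ℝ)).measurableEmbedding
  have hfi : Integrable (fun p : E × ℝ => f (WithLp.toLp 2 p)) ((volume : Measure E).prod volume) :=
    (hmp.integrable_comp_emb hemb).2 f.integrable
  have hs0 : ∀ᵐ s : ℝ, s ≠ 0 := by simp [ae_iff]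
  have habs : ∀ s : ℝ, s ≠ 0 → |s| ^ n * |((-2 * s) ^ n)⁻¹| = (2^n)⁻¹ := by
    intro s hs
    have : |s| ≠ 0 := abs_ne_zero.2 hs
    rw [abs_inv, abs_pow, abs_mul, mul_pow]
    simp
    field_simp
  have hint : Integrable (Function.uncurry fun (u : E) (s : ℝ) => ((|s| ^ n : ℝ) : ℂ) * f (WithLp.toLp 2 ((-2 * s) • u, s)))
      ((volume : Measure E).prod volume) := by
    rw [integrable_prod_iff']
    · constructor
      · filter_upwards [hfi.prod_left_ae, hs0] with s hs hs0
        have := (integrable_comp_smul_iff volume (fun u : E => f (WithLp.toLp 2 (u, s))) (show (-2 * s) ≠ 0 by simpa using hs0)).2 hs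
        exact this.const_mul ((|s| ^ n : ℝ) : ℂ)
      · refine (hfi.norm.integral_prod_right.const_mul ((2^n)⁻¹)).congr ?_
        filter_upwards [hs0] with s hs0
        simp only [Function.uncurry, norm_mul, Complex.norm_real]
        rw [integral_const_mul, Measure.integral_comp_smul volume (fun u : E => ‖f (WithLp.toLp 2 (u, s))‖),
          hn, smul_eq_mul, ← mul_assoc, Real.norm_of_nonneg (by positivity), habs s hs0]
    · apply Continuous.aestronglyMeasurable
      have := f.continuous
      unfold Function.uncurry
      fun_prop
  rw [integral_integral_swap hint, ← hmp.integral_comp hemb, Measure.volume_eq_prod, integral_prod_symm _ hfi,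
    ← integral_const_mul]
  apply integral_congr_ae
  filter_upwards [hs0] with s hs0
  rw [integral_const_mul, Measure.integral_comp_smul volume (fun u : E => f (WithLp.toLp 2 (u, s))), hn,
    Complex.real_smul, ← mul_assoc, ← Complex.ofReal_mul, habs s hs0]
  push_cast
  rfl

end Radon

section Main
open scoped FourierTransform SchwartzMap Topology
open Real Set

lemma exists_iteratedDeriv (ψ : 𝓢(ℝ, ℂ)) (n : ℕ) :
    ∃ χ : 𝓢(ℝ, ℂ), (∀ t, χ t = iteratedDeriv n ψ t) ∧
      ∀ s : ℝ, 𝓕 χ s = (2 * π * Complex.I * s) ^ n * 𝓕 ψ s := by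
  have h : ∀ m : ℕ, ∃ χ : 𝓢(ℝ, ℂ), (χ : ℝ → ℂ) = iteratedDeriv m ψ := by
    intro m
    induction m with
    | zero => exact ⟨ψ, by simp⟩
    | succ m ih =>
      obtain ⟨χ, hχ⟩ := ih
      refine ⟨SchwartzMap.derivCLM ℂ ℂ χ, ?_⟩
      ext t
      rw [SchwartzMap.derivCLM_apply, iteratedDeriv_succ, hχ]
  obtain ⟨χ, hχ⟩ := h n
  refine ⟨χ, fun t => by rw [hχ], fun s => ?_⟩
  have := Real.fourier_iteratedDeriv (f := ψ) (N := ⊤) (n := n) (ψ.smooth ⊤)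
    (fun m _ => by obtain ⟨χ, hχ⟩ := h m; rw [← hχ]; exact χ.integrable) le_top
  rw [SchwartzMap.fourier_coe, SchwartzMap.fourier_coe, hχ, this]
  rfl

lemma iteratedDeriv_ofReal_comp {r : ℝ → ℝ} {ψ : ℝ → ℂ} (hψ : ContDiff ℝ ((⊤ : ℕ∞) : WithTop ℕ∞) ψ)
    (h : ∀ t, ψ t = r t) (n : ℕ) (t : ℝ) : ((iteratedDeriv n r t : ℝ) : ℂ) = iteratedDeriv n ψ t := by
  have hr : ContDiff ℝ ((⊤ : ℕ∞) : WithTop ℕ∞) r := by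
    have : r = fun t => Complex.reCLM (ψ t) := by ext t; simp [h]
    rw [this]
    exact Complex.reCLM.contDiff.comp hψ
  have e : ψ = Complex.ofRealCLM ∘ r := by ext t; simp [h]
  rw [iteratedDeriv_eq_iteratedFDeriv, iteratedDeriv_eq_iteratedFDeriv, e,
    Complex.ofRealCLM.iteratedFDeriv_comp_left hr.contDiffAt (mod_cast le_top)]
  simp

lemma sign_mul_odd_pow (k : ℕ) (s : ℝ) : (SignType.sign s : ℝ) * s ^ (2 * k + 1) = |s| ^ (2 * k + 1) := by
  rw [pow_succ |s|, pow_mul |s|, sq_abs, ← pow_mul, ← sign_mul_self s, pow_succ]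
  ring

theorem main_aux (n : ℕ) (hodd : Odd n)
    (F : SchwartzMap (EuclideanSpace ℝ (Fin n) × ℝ) ℝ)
    (H : EuclideanSpace ℝ (Fin n) → ℝ → ℝ)
    (hH : ∀ (x : EuclideanSpace ℝ (Fin n)) (y : ℝ),
      Tendsto (fun ε : ℝ =>
          (1 / Real.pi) * ∫ t in {t : ℝ | ε < |y - t|},
            (iteratedDeriv n
              (fun s => ∫ u : EuclideanSpace ℝ (Fin n), F (x + u, s - ‖u‖ ^ 2)) t)
              / (y - t))
        (nhdsWithin 0 (Set.Ioi 0)) (nhds (H x y)))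
    (x : EuclideanSpace ℝ (Fin n)) (y : ℝ) :
    F (x, y) = (Real.pi ^ n)⁻¹ * (-1 : ℝ) ^ ((n - 1) / 2) *
      ∫ u : EuclideanSpace ℝ (Fin n), H (x + u) (y + ‖u‖ ^ 2) := by
  obtain ⟨k, hk⟩ := hodd
  have hpi := Real.pi_pos
  have hpc : (π:ℂ) ≠ 0 := by exact_mod_cast hpi.ne'
  have hk2 : (n - 1) / 2 = k := by omega
  obtain ⟨g, hg⟩ := exists_lift F x y
  have key : ∀ u : EuclideanSpace ℝ (Fin n), ((H (x + u) (y + ‖u‖ ^ 2) : ℝ) : ℂ) =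
      (-1) ^ k * (2 * π) ^ n * ∫ s : ℝ, ((|s| ^ n : ℝ) : ℂ) * 𝓕 g (WithLp.toLp 2 ((-2 * s) • u, s)) := by
    intro u
    obtain ⟨φ, hφ⟩ := exists_line (𝓕 g) u
    obtain ⟨kk, hkk⟩ := exists_shear g u
    set ψ : 𝓢(ℝ, ℂ) := 𝓕⁻ φ with hψ
    have hfψ : 𝓕 ψ = φ := by rw [hψ]; simp
    set r : ℝ → ℝ := fun s => ∫ v : EuclideanSpace ℝ (Fin n), F (x + u + v, s - ‖v‖ ^ 2) with hr
    set Y := y + ‖u‖ ^ 2 with hY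
    have hrψ : ∀ t : ℝ, ψ t = ((r (Y + t) : ℝ) : ℂ) := by
      intro t
      have e1 : ((r (Y + t) : ℝ) : ℂ) = ∫ w : EuclideanSpace ℝ (Fin n), kk (w, t) := by
        rw [hr, ← integral_complex_ofReal, ← integral_sub_right_eq_self _ u]
        congr 1
        ext w
        rw [hkk, hg]
        congr 3
        · abel
        · rw [norm_sub_sq_real, hY]; ring
      have e2 : 𝓕 (fun t : ℝ => ∫ w : EuclideanSpace ℝ (Fin n), kk (w, t)) = φ := by
        ext s
        rw [hφ, ← fourier_fiber]
        simp_rw [hkk]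
      have e3 := (continuous_fiber kk).fourierInv_fourier_eq (integrable_fiber kk)
        (by rw [e2]; exact φ.integrable)
      rw [e1, hψ, SchwartzMap.fourierInv_coe, ← e2, e3]
    obtain ⟨χ, hχ1, hχ2⟩ := exists_iteratedDeriv ψ n
    have hD : ∀ t : ℝ, ((iteratedDeriv n r (Y + t) : ℝ) : ℂ) = χ t := by
      intro t
      rw [hχ1, ← iteratedDeriv_ofReal_comp (r := fun t => r (Y + t)) (ψ.smooth ⊤) hrψ,
        iteratedDeriv_comp_const_add]
    have hlim := (Complex.continuous_ofReal.tendsto _).comp (hH (x + u) Y)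
    have hlim2 : Tendsto (fun ε : ℝ => -(1 / (π:ℂ)) * ∫ t in {t : ℝ | ε < |t|}, χ t / (t:ℂ)) (𝓝[>] 0)
        (𝓝 ((H (x + u) Y : ℝ) : ℂ)) := by
      refine hlim.congr fun ε => ?_
      have hm : MeasurableSet {t : ℝ | ε < |t|} := measurableSet_lt measurable_const (by fun_prop)
      have hm' : MeasurableSet {t : ℝ | ε < |Y - t|} := measurableSet_lt measurable_const (by fun_prop)
      simp only [Function.comp_apply]
      rw [Complex.ofReal_mul, ← integral_complex_ofReal, neg_mul, ← mul_neg, ← integral_neg,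
        ← integral_indicator hm, ← integral_indicator hm', ← integral_add_left_eq_self _ Y]
      push_cast
      congr 2
      ext t
      simp only [indicator, mem_ofPred_eq, sub_add_cancel_left, abs_neg]
      split_ifs
      · rw [← hD t]
        push_cast
        rw [sub_add_cancel_left, div_neg]
      · rfl
    have := tendsto_nhds_unique hlim2 ((tendsto_pv χ).const_mul _)
    rw [this, hilbert_identity]
    have e4 : ∀ s : ℝ, ((SignType.sign s : ℝ) : ℂ) * 𝓕 χ s =
        (2 * π * Complex.I) ^ n * (((|s| ^ n : ℝ) : ℂ) * 𝓕 g (WithLp.toLp 2 ((-2 * s) • u, s))) := by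
      intro s
      have e := sign_mul_odd_pow k s
      rw [← hk] at e
      rw [hχ2, hfψ, hφ, ← e, mul_pow _ (s:ℂ)]
      push_cast
      ring
    simp_rw [e4]
    rw [integral_const_mul]
    have e5 : (2 * (π:ℂ) * Complex.I) ^ n = (2 * π) ^ n * ((-1) ^ k * Complex.I) := by
      rw [mul_pow, hk, pow_succ Complex.I, pow_mul, Complex.I_sq]
    rw [e5]
    field_simp
    rw [Complex.I_sq]
    ring
  have h1 : ((∫ u : EuclideanSpace ℝ (Fin n), H (x + u) (y + ‖u‖ ^ 2) : ℝ) : ℂ) =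
      (-1) ^ k * (π:ℂ) ^ n * F (x, y) := by
    rw [← integral_complex_ofReal]
    simp_rw [key]
    rw [integral_const_mul, radon_integral (𝓕 g) n (by simp)]
    have e6 : ∫ v, 𝓕 g v = (F (x, y) : ℂ) := by
      have h0 : 𝓕⁻ (𝓕 g) 0 = g 0 := by simp
      rw [SchwartzMap.fourierInv_coe, Real.fourierInv_eq'] at h0
      simp only [inner_zero_right, mul_zero, Complex.ofReal_zero, zero_mul, Complex.exp_zero, one_smul] at h0
      rw [h0]
      have := hg 0 0
      have hz : WithLp.toLp 2 ((0 : EuclideanSpace ℝ (Fin n)), (0 : ℝ)) = 0 := rfl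
      rw [hz] at this
      simpa using this
    rw [e6, mul_pow]
    field_simp
  have h2 : (∫ u : EuclideanSpace ℝ (Fin n), H (x + u) (y + ‖u‖ ^ 2)) =
      (-1) ^ k * π ^ n * F (x, y) := by exact_mod_cast h1
  rw [h2, hk2]
  have : ((-1:ℝ) ^ k) * (-1) ^ k = 1 := by rw [← mul_pow]; simp
  field_simp
  linear_combination (-F (x, y)) * this

end Main

theorem stmt15 (n : ℕ) (hodd : Odd n)
    (F : SchwartzMap (EuclideanSpace ℝ (Fin n) × ℝ) ℝ)
    (H : EuclideanSpace ℝ (Fin n) → ℝ → ℝ)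
    (hH : ∀ (x : EuclideanSpace ℝ (Fin n)) (y : ℝ),
      Tendsto (fun ε : ℝ =>
          (1 / Real.pi) * ∫ t in {t : ℝ | ε < |y - t|},
            (iteratedDeriv n
              (fun s => ∫ u : EuclideanSpace ℝ (Fin n), F (x + u, s - ‖u‖ ^ 2)) t)
              / (y - t))
        (nhdsWithin 0 (Set.Ioi 0)) (nhds (H x y)))
    (x : EuclideanSpace ℝ (Fin n)) (y : ℝ) :
    F (x, y) = (Real.pi ^ n)⁻¹ * (-1 : ℝ) ^ ((n - 1) / 2) *
      ∫ u : EuclideanSpace ℝ (Fin n), H (x + u) (y + ‖u‖ ^ 2) :=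
  main_aux n hodd F H hH x y
end

section
/- Let n ≥ 2 be even. For F ∈ 𝒮(ℝⁿ × ℝ), the inversion formula F = π^{−n} (P* ∘ Λ_y ∘ P)(F) holds, where P(F)(x,y) = ∫_{ℝⁿ} F(x+u, y−|u|²) du, P*(G)(x,y) = ∫_{ℝⁿ} G(x+u, y+|u|²) du, and Λ_y = (−1)^{n/2} ∂_y^n. -/
open MeasureTheory
open FourierTransform SchwartzMap
open scoped Real

abbrev Es (n : ℕ) : Type := EuclideanSpace ℝ (Fin n)

/-- Pullback of a Schwartz function by the parabolic shear. -/
theorem exists_pullback (n : ℕ) (F : SchwartzMap (EuclideanSpace ℝ (Fin n) × ℝ) ℝ)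
    (x : EuclideanSpace ℝ (Fin n)) (y : ℝ) :
    ∃ H : SchwartzMap (WithLp 2 (EuclideanSpace ℝ (Fin n) × ℝ)) ℂ,
      ∀ v t, H (WithLp.toLp 2 (v, t)) = ((F (x + v, y + t - ‖v‖ ^ 2) : ℝ) : ℂ) := by
  let E := EuclideanSpace ℝ (Fin n)
  let g : E × ℝ → E × ℝ := fun p => (x + p.1, y + p.2 - ‖p.1‖ ^ 2)
  have hgrow : g.HasTemperateGrowth := by
    have h1 : Function.HasTemperateGrowth (fun p : E × ℝ => p.1) :=
      (ContinuousLinearMap.fst ℝ E ℝ).hasTemperateGrowth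
    have h2 : Function.HasTemperateGrowth (fun p : E × ℝ => p.2) :=
      (ContinuousLinearMap.snd ℝ E ℝ).hasTemperateGrowth
    have h3 : Function.HasTemperateGrowth (fun p : E × ℝ => ‖p.1‖ ^ 2) :=
      (Function.hasTemperateGrowth_norm_sq (H := E)).comp h1
    have h4 : Function.HasTemperateGrowth (fun p : E × ℝ => x + p.1) :=
      (Function.HasTemperateGrowth.const x).add h1
    have h5 : Function.HasTemperateGrowth (fun p : E × ℝ => y + p.2 - ‖p.1‖ ^ 2) :=
      ((Function.HasTemperateGrowth.const y).add h2).sub h3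
    have h6 := ((ContinuousLinearMap.inl ℝ E ℝ).hasTemperateGrowth.comp h4).add
      ((ContinuousLinearMap.inr ℝ E ℝ).hasTemperateGrowth.comp h5)
    convert h6 using 1
    ext p <;> simp [g]
  have hup : ∃ (k : ℕ) (C : ℝ), ∀ p, ‖p‖ ≤ C * (1 + ‖g p‖) ^ k := by
    refine ⟨2, (1 + ‖x‖ + |y|) ^ 2 * 2, fun p => ?_⟩
    set r := ‖g p‖
    set a := ‖x‖
    have ha : 0 ≤ a := norm_nonneg _
    have hy : 0 ≤ |y| := abs_nonneg _
    have hr : 0 ≤ r := norm_nonneg _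
    have h1 : ‖p.1‖ ≤ r + a := by
      have : p.1 = (g p).1 - x := by simp [g]
      rw [this]
      exact (norm_sub_le _ _).trans (by gcongr; exact norm_fst_le _)
    have h2 : ‖p.2‖ ≤ r + |y| + (r + a) ^ 2 := by
      have : p.2 = (g p).2 - y + ‖p.1‖ ^ 2 := by simp only [g]; ring
      rw [this]
      refine (norm_add_le _ _).trans ?_
      refine add_le_add ((norm_sub_le _ _).trans ?_) ?_
      · rw [Real.norm_eq_abs y]; gcongr; exact norm_snd_le _
      · rw [norm_pow, norm_norm]; gcongr
    rw [Prod.norm_def]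
    have key : r + a ≤ (1 + a + |y|) * (1 + r) := by nlinarith [mul_nonneg ha hr, mul_nonneg hy hr]
    have key2 : r + |y| ≤ (1 + a + |y|) * (1 + r) := by
      nlinarith [mul_nonneg ha hr, mul_nonneg hy hr]
    have key3 : 1 ≤ (1 + a + |y|) * (1 + r) := by
      nlinarith [mul_nonneg ha hr, mul_nonneg hy hr]
    have e : (1 + a + |y|) ^ 2 * 2 * (1 + r) ^ 2 = 2 * ((1 + a + |y|) * (1 + r)) ^ 2 := by ring
    rw [e]
    set m := (1 + a + |y|) * (1 + r)
    have : (r + a) ^ 2 ≤ m ^ 2 := by gcongr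
    refine max_le ?_ ?_ <;> nlinarith
  refine ⟨SchwartzMap.compCLMOfContinuousLinearEquiv ℝ (WithLp.prodContinuousLinearEquiv 2 ℝ E ℝ)
    (SchwartzMap.postcompCLM Complex.ofRealCLM (SchwartzMap.compCLM ℝ hgrow hup F)), fun v t => ?_⟩
  simp [g]

/-- Partial integral of a Schwartz function: continuity. -/
theorem partial_continuous (n : ℕ) (K : SchwartzMap ((Es n) × ℝ) ℂ) :
    Continuous (fun t : ℝ => ∫ v : Es n, K (v, t)) := by
  obtain ⟨C, hC⟩ : ∃ C, ∀ v t, ‖K (v, t)‖ ≤ C * (1 + ‖v‖) ^ (-((n : ℝ) + 1)) := by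
    refine ⟨2 ^ (n + 1) * ((Finset.Iic (n + 1, 0)).sup
      (fun m => SchwartzMap.seminorm ℝ m.1 m.2)) K, fun v t => ?_⟩
    have h := SchwartzMap.one_add_le_sup_seminorm_apply (𝕜 := ℝ) (m := (n + 1, 0)) (k := n + 1)
      (n := 0) le_rfl le_rfl K (v, t)
    rw [norm_iteratedFDeriv_zero] at h
    have hv : (0 : ℝ) < 1 + ‖v‖ := by positivity
    rw [Real.rpow_neg hv.le, ← div_eq_mul_inv, le_div_iff₀ (by positivity), mul_comm]
    refine le_trans ?_ h
    have : (1 + ‖v‖) ^ ((n : ℝ) + 1) = (1 + ‖v‖) ^ (n + 1) := by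
      rw [← Real.rpow_natCast]; simp
    rw [this]
    gcongr
    exact norm_fst_le (v, t)
  refine continuous_of_dominated (bound := fun v : Es n => C * (1 + ‖v‖) ^ (-((n : ℝ) + 1)))
    (fun t => ?_) (fun t => ?_) ?_ ?_
  · exact (K.continuous.comp (by fun_prop)).aestronglyMeasurable
  · exact Filter.Eventually.of_forall (fun v => hC v t)
  · exact (integrable_one_add_norm (by simp)).const_mul C
  · exact Filter.Eventually.of_forall (fun v => K.continuous.comp (by fun_prop))

noncomputable def shearE (n : ℕ) (u : Es n) :
    ((Es n) × ℝ) ≃L[ℝ] WithLp 2 ((Es n) × ℝ) :=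
  (LinearEquiv.toContinuousLinearEquiv
    { toFun := fun p => (p.1, p.2 + 2 * inner ℝ u p.1)
      invFun := fun p => (p.1, p.2 - 2 * inner ℝ u p.1)
      map_add' := fun p q => by ext <;> simp [inner_add_right]; ring
      map_smul' := fun c p => by ext <;> simp [inner_smul_right]; ring
      left_inv := fun p => by simp
      right_inv := fun p => by simp }).trans (WithLp.prodContinuousLinearEquiv 2 ℝ (Es n) ℝ).symm

theorem shearE_apply (n : ℕ) (u v : Es n) (t : ℝ) :
    shearE n u (v, t) = WithLp.toLp 2 (v, t + 2 * inner ℝ u v) := rfl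

theorem haar_prod (n : ℕ) : (volume : Measure ((Es n) × ℝ)).IsAddHaarMeasure := by
  rw [Measure.volume_eq_prod]; infer_instance

theorem integral_W {n : ℕ} (f : WithLp 2 ((Es n) × ℝ) → ℂ) :
    ∫ w, f w = ∫ p : (Es n) × ℝ, f (WithLp.toLp 2 p) :=
  ((WithLp.volume_preserving_toLp (Es n) ℝ).integral_comp
    (MeasurableEquiv.toLp 2 ((Es n) × ℝ)).measurableEmbedding f).symm

theorem fourier_slice (n : ℕ) (H : SchwartzMap (WithLp 2 ((Es n) × ℝ)) ℂ) (u : Es n) (τ : ℝ) :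
    𝓕 (fun t : ℝ => ∫ v : Es n, H (WithLp.toLp 2 (v, t + 2 * inner ℝ u v))) τ
      = 𝓕 H (WithLp.toLp 2 (-(2 * τ) • u, τ)) := by
  have := haar_prod n
  set K : SchwartzMap ((Es n) × ℝ) ℂ := SchwartzMap.compCLMOfContinuousLinearEquiv ℝ (shearE n u) H
    with hK
  have hKa : ∀ v t, K (v, t) = H (WithLp.toLp 2 (v, t + 2 * inner ℝ u v)) := fun v t => rfl
  rw [SchwartzMap.fourier_coe, Real.fourier_eq, Real.fourier_eq, integral_W]
  simp_rw [← hKa]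
  have hint1 : Integrable (fun p : (Es n) × ℝ => Real.fourierChar (-inner ℝ p.2 τ) • K p) := by
    have := K.integrable (μ := volume)
    refine (integrable_norm_iff ?_).1 ?_
    · refine Continuous.aestronglyMeasurable ?_
      have := K.continuous
      have h2 := Real.continuous_fourierChar
      fun_prop
    · simpa [Circle.norm_smul] using this.norm
  have hint2 : Integrable (fun p : (Es n) × ℝ =>
      Real.fourierChar (-inner ℝ (WithLp.toLp 2 p) (WithLp.toLp 2 (-(2 * τ) • u, τ))) •
        H (WithLp.toLp 2 p)) := by
    have h1 : Integrable (fun p : (Es n) × ℝ => H (WithLp.toLp 2 p)) :=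
      (SchwartzMap.compCLMOfContinuousLinearEquiv ℝ
        (WithLp.prodContinuousLinearEquiv 2 ℝ (Es n) ℝ).symm H).integrable (μ := volume)
    refine (integrable_norm_iff ?_).1 ?_
    · refine Continuous.aestronglyMeasurable ?_
      have := H.continuous
      have h2 := Real.continuous_fourierChar
      fun_prop
    · simpa [Circle.norm_smul] using h1.norm
  rw [Measure.volume_eq_prod] at hint1 hint2
  rw [Measure.volume_eq_prod, integral_prod _ hint2]
  have hs : ∀ t : ℝ, Real.fourierChar (-inner ℝ t τ) • ∫ v : Es n, K (v, t)
      = ∫ v : Es n, Real.fourierChar (-inner ℝ t τ) • K (v, t) := fun t => by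
    simp_rw [Circle.smul_def]
    rw [integral_smul]
  simp_rw [hs]
  rw [integral_integral_swap (f := fun (t : ℝ) (v : Es n) => Real.fourierChar (-inner ℝ t τ) • K (v, t))]
  swap
  · exact hint1.swap
  congr 1
  ext v
  rw [← integral_add_right_eq_self (fun t : ℝ => Real.fourierChar
    (-inner ℝ (WithLp.toLp 2 (v, t)) (WithLp.toLp 2 (-(2 * τ) • u, τ))) •
      H (WithLp.toLp 2 (v, t))) (2 * inner ℝ u v)]
  congr 1
  ext t
  rw [hKa]
  congr 3
  simp [WithLp.prod_inner_apply, inner_smul_right, real_inner_comm]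
  ring


theorem slice_eq (n : ℕ) (H : SchwartzMap (WithLp 2 ((Es n) × ℝ)) ℂ) (u : Es n) :
    ∃ φ : SchwartzMap ℝ ℂ, (∀ τ, φ τ = 𝓕 H (WithLp.toLp 2 ((2 * τ) • u, -τ))) ∧
    (fun t : ℝ => ∫ v : Es n, H (WithLp.toLp 2 (v, t + 2 * inner ℝ u v))) = 𝓕 φ := by
  have := haar_prod n
  let L : ℝ →L[ℝ] WithLp 2 ((Es n) × ℝ) :=
    (WithLp.prodContinuousLinearEquiv 2 ℝ (Es n) ℝ).symm.toContinuousLinearMap ∘L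
      (ContinuousLinearMap.toSpanSingleton ℝ ((2 : ℝ) • u, (-1 : ℝ)))
  have hLa : ∀ τ, L τ = WithLp.toLp 2 ((2 * τ) • u, -τ) := fun τ => by
    simp [L, smul_smul, mul_comm]
  have hanti : AntilipschitzWith 1 L := by
    refine AddMonoidHomClass.antilipschitz_of_bound L (fun τ => ?_)
    rw [hLa]
    have h := WithLp.prod_norm_sq_eq_of_L2 (WithLp.toLp 2 ((2 * τ) • u, -τ))
    have h3 : ‖(WithLp.toLp 2 ((2 * τ) • u, -τ)).snd‖ = ‖τ‖ := norm_neg τ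
    rw [h3] at h
    have h1 := norm_nonneg (WithLp.toLp 2 ((2 * τ) • u, -τ))
    simp only [NNReal.coe_one, one_mul]
    refine abs_le_of_sq_le_sq' ?_ h1 |>.2
    rw [h]
    exact le_add_of_nonneg_left (sq_nonneg _)
  let φ : SchwartzMap ℝ ℂ :=
    SchwartzMap.compCLMOfAntilipschitz ℝ L.hasTemperateGrowth hanti (𝓕 H)
  have hφ : ∀ τ, φ τ = 𝓕 H (WithLp.toLp 2 ((2 * τ) • u, -τ)) := fun τ => by
    rw [← hLa]; rfl
  refine ⟨φ, hφ, ?_⟩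
  set k := (fun t : ℝ => ∫ v : Es n, H (WithLp.toLp 2 (v, t + 2 * inner ℝ u v))) with hk
  set K : SchwartzMap ((Es n) × ℝ) ℂ := SchwartzMap.compCLMOfContinuousLinearEquiv ℝ (shearE n u) H
    with hK
  have hkK : k = fun t => ∫ v : Es n, K (v, t) := rfl
  have hc : Continuous k := by rw [hkK]; exact partial_continuous n K
  have hi : Integrable k := by
    have h := K.integrable (μ := volume)
    rw [Measure.volume_eq_prod] at h
    exact h.integral_prod_right
  have hf : 𝓕 k = fun τ => φ (-τ) := by
    ext τ
    rw [hφ, hk, fourier_slice]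
    simp
  have hfi : Integrable (𝓕 k) := by
    rw [hf]; exact φ.integrable.comp_neg
  rw [← hc.fourierInv_fourier_eq hi hfi, hf, SchwartzMap.fourier_coe,
    Real.fourierInv_eq_fourier_comp_neg]
  simp

theorem slice_deriv (n : ℕ) (H : SchwartzMap (WithLp 2 ((Es n) × ℝ)) ℂ) (u : Es n) :
    ContDiff ℝ n (fun t : ℝ => ∫ v : Es n, H (WithLp.toLp 2 (v, t + 2 * inner ℝ u v))) ∧
    iteratedDeriv n (fun t : ℝ => ∫ v : Es n, H (WithLp.toLp 2 (v, t + 2 * inner ℝ u v))) 0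
      = ∫ τ : ℝ, (-2 * π * Complex.I * τ) ^ n * 𝓕 H (WithLp.toLp 2 ((2 * τ) • u, -τ)) := by
  obtain ⟨φ, hφ, h⟩ := slice_eq n H u
  rw [h]
  refine ⟨(𝓕 φ).smooth n, ?_⟩
  rw [SchwartzMap.fourier_coe, Real.iteratedDeriv_fourier (N := ⊤) (fun m _ => ?_) le_top,
    Real.fourier_eq]
  · simp [hφ]
  · have := φ.integrable_pow_mul volume m
    refine (integrable_norm_iff ?_).1 ?_
    · have := φ.continuous
      exact Continuous.aestronglyMeasurable (by fun_prop)
    · simpa [norm_smul] using this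

theorem main_fubini (n : ℕ) (hn : 2 ≤ n) (heven : Even n)
    (H : SchwartzMap (WithLp 2 ((Es n) × ℝ)) ℂ) :
    Integrable (fun u : Es n =>
      ∫ τ : ℝ, (-2 * π * Complex.I * τ) ^ n * 𝓕 H (WithLp.toLp 2 ((2 * τ) • u, -τ))) ∧
    ∫ u : Es n, ∫ τ : ℝ, (-2 * π * Complex.I * τ) ^ n * 𝓕 H (WithLp.toLp 2 ((2 * τ) • u, -τ))
      = π ^ n * (-1) ^ (n / 2) * H 0 := by
  have := haar_prod n
  set G := 𝓕 H with hG
  have hHG : H 0 = ∫ τ : ℝ, ∫ v : Es n, G (WithLp.toLp 2 (v, -τ)) := by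
    have h1 : Integrable (fun p : (Es n) × ℝ => G (WithLp.toLp 2 p)) :=
      (SchwartzMap.compCLMOfContinuousLinearEquiv ℝ
        (WithLp.prodContinuousLinearEquiv 2 ℝ (Es n) ℝ).symm G).integrable (μ := volume)
    have h2 : H = 𝓕⁻ G := by simp [hG]
    rw [h2, SchwartzMap.fourierInv_coe, Real.fourierInv_eq]
    simp only [inner_zero_right, AddChar.map_zero_eq_one, one_smul]
    rw [Measure.volume_eq_prod] at h1
    rw [integral_W, Measure.volume_eq_prod, integral_prod_symm _ h1,
      ← integral_neg_eq_self (fun τ : ℝ => ∫ v : Es n, G (WithLp.toLp 2 (v, τ)))]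
  have hsmul : ∀ (τ : ℝ), τ ≠ 0 → ∀ {A : Type} [NormedAddCommGroup A] [NormedSpace ℝ A] (f : Es n → A),
      ∫ u : Es n, f ((2 * τ) • u) = ((2 * τ) ^ n)⁻¹ • ∫ u : Es n, f u := by
    intro τ hτ A _ _ f
    rw [Measure.integral_comp_smul]
    simp only [finrank_euclideanSpace, Fintype.card_fin]
    rw [abs_of_nonneg]
    exact inv_nonneg.2 (heven.pow_nonneg _)
  have hval : ∀ τ : ℝ, τ ≠ 0 → ∫ u : Es n, (-2 * π * Complex.I * τ) ^ n *
      G (WithLp.toLp 2 ((2 * τ) • u, -τ)) =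
      (π ^ n * (-1) ^ (n / 2)) * ∫ v : Es n, G (WithLp.toLp 2 (v, -τ)) := by
    intro τ hτ
    rw [integral_const_mul, hsmul τ hτ (fun v => G (WithLp.toLp 2 (v, -τ))), Complex.real_smul,
      ← mul_assoc]
    congr 1
    obtain ⟨m, hm⟩ := heven
    have hm2 : n / 2 = m := by omega
    have hI : Complex.I ^ n = (-1) ^ m := by
      rw [hm, ← two_mul, pow_mul, Complex.I_sq]
    have hτ' : (τ : ℂ) ≠ 0 := by exact_mod_cast hτ
    have : (-2 * π * Complex.I * τ : ℂ) ^ n = (2 * τ) ^ n * (π ^ n * Complex.I ^ n) := by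
      rw [← mul_pow, ← mul_pow, ← Even.neg_pow ⟨m, hm⟩]
      congr 1; ring
    rw [this, hI, hm2]
    push_cast
    have h2 : ((2 : ℂ) * τ) ^ n ≠ 0 := pow_ne_zero _ (mul_ne_zero two_ne_zero hτ')
    field_simp
  have hae : ∀ᵐ τ : ℝ, τ ≠ 0 := by
    simp [ae_iff, measure_singleton]
  have hprod : Integrable (fun p : (Es n) × ℝ => G (WithLp.toLp 2 (p.1, -p.2)))
      ((volume : Measure (Es n)).prod volume) := by
    have h1 : Integrable (fun p : (Es n) × ℝ => G (WithLp.toLp 2 p)) :=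
      (SchwartzMap.compCLMOfContinuousLinearEquiv ℝ
        (WithLp.prodContinuousLinearEquiv 2 ℝ (Es n) ℝ).symm G).integrable (μ := volume)
    rw [Measure.volume_eq_prod] at h1
    exact (((MeasurePreserving.id (volume : Measure (Es n))).prod
      (Measure.measurePreserving_neg (volume : Measure ℝ))).integrable_comp
        h1.aestronglyMeasurable).2 h1
  have hjoint : Integrable (fun p : (Es n) × ℝ => (-2 * π * Complex.I * p.2) ^ n *
      G (WithLp.toLp 2 ((2 * p.2) • p.1, -p.2))) ((volume : Measure (Es n)).prod volume) := by
    have hmeas : AEStronglyMeasurable (fun p : (Es n) × ℝ => (-2 * π * Complex.I * p.2) ^ n *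
      G (WithLp.toLp 2 ((2 * p.2) • p.1, -p.2))) ((volume : Measure (Es n)).prod volume) := by
      have := G.continuous
      exact Continuous.aestronglyMeasurable (by fun_prop)
    rw [integrable_prod_iff' hmeas]
    rw [integrable_prod_iff' hprod.aestronglyMeasurable] at hprod
    constructor
    · filter_upwards [hae, hprod.1] with τ hτ h
      exact (h.comp_smul (mul_ne_zero two_ne_zero hτ)).const_mul _
    · refine (hprod.2.const_mul (π ^ n)).congr ?_
      filter_upwards [hae] with τ hτ
      simp only [norm_mul]
      rw [integral_const_mul, hsmul τ hτ (fun v => ‖G (WithLp.toLp 2 (v, -τ))‖), smul_eq_mul,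
        ← mul_assoc]
      congr 1
      simp only [norm_pow, norm_mul, norm_neg, Complex.norm_I, Complex.norm_real]
      rw [← heven.pow_abs (2 * τ), abs_mul]
      have hp : |π| = π := abs_of_pos Real.pi_pos
      have h2 : (|(2:ℝ)| * |τ|) ^ n ≠ 0 := by positivity
      simp [hp, mul_pow]
      field_simp
  refine ⟨hjoint.integral_prod_left, ?_⟩
  rw [integral_integral_swap hjoint, hHG, ← integral_const_mul]
  refine integral_congr_ae ?_
  filter_upwards [hae] with τ hτ
  exact hval τ hτ

theorem stmt16 (n : ℕ) (hn : 2 ≤ n) (heven : Even n)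
    (F : SchwartzMap (EuclideanSpace ℝ (Fin n) × ℝ) ℝ)
    (x : EuclideanSpace ℝ (Fin n)) (y : ℝ) :
    F (x, y) = (Real.pi ^ n)⁻¹ * (-1 : ℝ) ^ (n / 2) *
      ∫ u : EuclideanSpace ℝ (Fin n),
        iteratedDeriv n
          (fun s => ∫ w : EuclideanSpace ℝ (Fin n), F (x + u + w, s - ‖w‖ ^ 2))
          (y + ‖u‖ ^ 2) := by
  obtain ⟨H, hH⟩ := exists_pullback n F x y
  obtain ⟨hint, hmain⟩ := main_fubini n hn heven H
  have hH0 : H 0 = (F (x, y) : ℂ) := by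
    have h := hH 0 0
    have h0 : (WithLp.toLp 2 ((0 : EuclideanSpace ℝ (Fin n)), (0 : ℝ))) = 0 := rfl
    rw [h0] at h
    simpa using h
  have hin : ∀ u : Es n, iteratedDeriv n
          (fun s => ∫ w : EuclideanSpace ℝ (Fin n), F (x + u + w, s - ‖w‖ ^ 2))
          (y + ‖u‖ ^ 2) = (∫ τ : ℝ, (-2 * π * Complex.I * τ) ^ n *
            𝓕 H (WithLp.toLp 2 ((2 * τ) • u, -τ))).re := by
    intro u
    obtain ⟨hcd, hder⟩ := slice_deriv n H u
    rw [← hder]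
    set k := (fun t : ℝ => ∫ v : Es n, H (WithLp.toLp 2 (v, t + 2 * inner ℝ u v))) with hk
    have e1 : (fun s => ∫ w : EuclideanSpace ℝ (Fin n), F (x + u + w, s - ‖w‖ ^ 2)) =
        fun s => (Complex.reCLM ∘ k) (s - (y + ‖u‖ ^ 2)) := by
      ext s
      rw [← integral_sub_right_eq_self _ u]
      simp only [hk, Function.comp, hH, Complex.reCLM_apply]
      rw [integral_complex_ofReal, Complex.ofReal_re]
      congr 1
      ext v
      congr 2
      · abel
      · rw [norm_sub_sq_real, real_inner_comm]; ring
    rw [e1, iteratedDeriv_comp_sub_const]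
    simp only [sub_self]
    rw [iteratedDeriv_eq_iteratedFDeriv,
      ContinuousLinearMap.iteratedFDeriv_comp_left _ hcd.contDiffAt le_rfl,
      iteratedDeriv_eq_iteratedFDeriv]
    rfl
  simp_rw [hin]
  have hre := integral_re hint
  simp only [RCLike.re_eq_complex_re] at hre
  rw [hre, hmain, hH0]
  have : (π ^ n * (-1) ^ (n / 2) * (F (x, y) : ℂ)) =
      ((π ^ n * (-1) ^ (n / 2) * F (x, y) : ℝ) : ℂ) := by push_cast; rfl
  rw [this, Complex.ofReal_re]
  have h1 : ((-1 : ℝ) ^ (n / 2)) * (-1) ^ (n / 2) = 1 := by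
    rw [← mul_pow]; simp
  have h2 : π ^ n ≠ 0 := by positivity
  field_simp
  linear_combination (-F (x, y)) * h1
end

section
/- Fix a unit vector (ω,θ) ∈ Sⁿ ⊂ ℝⁿ × ℝ with θ ≠ 0. For φ ∈ 𝒮(ℝ), the inversion formula φ = (|θ|ⁿ/πⁿ) (Q* ∘ Λ_p ∘ Q)(φ) holds, where Q(φ)(p) = ∫_{ℝⁿ} φ(p + ω·u − θ|u|²) du, Q*(ψ)(p) = ∫_{ℝⁿ} ψ(p + ω·v + θ|v|²) dv, and Λ_p is the operator with Fourier symbol |ξ|ⁿ (namely Λ_p = (−1)^{(n−1)/2} H_p ∘ ∂_p^n for odd n and (−1)^{n/2} ∂_p^n for even n, with H_p the Hilbert transform). -/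
open MeasureTheory Filter
open scoped RealInnerProductSpace

namespace Parab

def G (θ : ℝ) (h : ℝ → ℝ) : Prop :=
  Continuous h ∧ ∀ (s : ℝ) (N : ℕ), ∃ C : ℝ, 0 ≤ C ∧ ∀ y : ℝ, 0 ≤ y →
    |h (s - θ * y)| ≤ C * ((1 + y) ^ N)⁻¹

noncomputable def J (θ : ℝ) (h : ℝ → ℝ) (s : ℝ) : ℝ := ∫ w : ℝ, h (s - θ * w ^ 2)

noncomputable def A (θ : ℝ) (n : ℕ) (h : ℝ → ℝ) (s : ℝ) : ℝ :=
  ∫ v : EuclideanSpace ℝ (Fin n), h (s - θ * ‖v‖ ^ 2)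

lemma intN (n N : ℕ) (hN : n < 2 * N) :
    Integrable (fun v : EuclideanSpace ℝ (Fin n) => ((1 + ‖v‖ ^ 2) ^ N)⁻¹) := by
  have := integrable_rpow_neg_one_add_norm_sq (E := EuclideanSpace ℝ (Fin n))
    (μ := volume) (r := 2 * (N : ℝ)) (by simp; exact_mod_cast hN)
  refine this.congr (ae_of_all _ fun v => ?_)
  have h1 : (-(2 * (N : ℝ)) / 2) = -(N : ℝ) := by ring
  simp only [h1]
  rw [Real.rpow_neg (by positivity), Real.rpow_natCast]

lemma int1 : Integrable (fun w : ℝ => ((1 + w ^ 2) ^ 1)⁻¹) := by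
  simpa using integrable_inv_one_add_sq

lemma inv_split (a b : ℝ) (ha : 0 ≤ a) (hb : 0 ≤ b) (N M : ℕ) :
    ((1 + (a + b)) ^ (N + M))⁻¹ ≤ ((1 + a) ^ N)⁻¹ * ((1 + b) ^ M)⁻¹ := by
  rw [← mul_inv, pow_add]
  gcongr <;> linarith

lemma prod_int {θ : ℝ} {h : ℝ → ℝ} (hh : G θ h) (n : ℕ) (s : ℝ) :
    Integrable (fun z : ℝ × EuclideanSpace ℝ (Fin n) =>
      h (s - θ * (z.1 ^ 2 + ‖z.2‖ ^ 2))) (volume.prod volume) := by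
  obtain ⟨C, hC, hb⟩ := hh.2 s (1 + (n + 1))
  have hc := hh.1
  refine ((int1.mul_prod (intN n (n+1) (by omega))).const_mul C).mono'
    (by apply Continuous.aestronglyMeasurable; fun_prop) (ae_of_all _ fun z => ?_)
  rw [Real.norm_eq_abs]
  refine (hb _ (by positivity)).trans ?_
  gcongr
  exact inv_split _ _ (by positivity) (by positivity) _ _

lemma prod_int1 {θ : ℝ} {h : ℝ → ℝ} (hh : G θ h) (s : ℝ) :
    Integrable (fun z : ℝ × ℝ =>
      h (s - θ * (z.1 ^ 2 + z.2 ^ 2))) (volume.prod volume) := by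
  obtain ⟨C, hC, hb⟩ := hh.2 s (1 + 1)
  have hc := hh.1
  refine ((int1.mul_prod int1).const_mul C).mono'
    (by apply Continuous.aestronglyMeasurable; fun_prop) (ae_of_all _ fun z => ?_)
  rw [Real.norm_eq_abs]
  refine (hb _ (by positivity)).trans ?_
  gcongr
  exact inv_split _ _ (by positivity) (by positivity) _ _

lemma integral_succ (n : ℕ) (f : ℝ → ℝ) :
    ∫ v : EuclideanSpace ℝ (Fin (n + 1)), f (‖v‖ ^ 2) =
      ∫ z : ℝ × EuclideanSpace ℝ (Fin n), f (z.1 ^ 2 + ‖z.2‖ ^ 2) ∂(volume.prod volume) := by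
  have e1 := (EuclideanSpace.volume_preserving_symm_measurableEquiv_toLp (Fin (n+1))).symm
  have e2 := (volume_preserving_piFinSuccAbove (fun _ : Fin (n+1) => ℝ) 0).symm
  have e3 := (MeasurePreserving.id (volume : Measure ℝ)).prod
    (EuclideanSpace.volume_preserving_symm_measurableEquiv_toLp (Fin n))
  have m3 : MeasurableEmbedding (Prod.map id (MeasurableEquiv.toLp 2 (Fin n → ℝ)).symm :
      ℝ × EuclideanSpace ℝ (Fin n) → ℝ × (Fin n → ℝ)) :=
    ((MeasurableEquiv.refl ℝ).prodCongr
      (MeasurableEquiv.toLp 2 (Fin n → ℝ)).symm).measurableEmbedding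
  rw [← e1.integral_comp (MeasurableEquiv.measurableEmbedding _),
    ← e2.integral_comp (MeasurableEquiv.measurableEmbedding _)]
  erw [← e3.integral_comp m3]
  apply integral_congr_ae
  refine ae_of_all _ fun z => ?_
  simp only [EuclideanSpace.norm_sq_eq]
  rw [Fin.sum_univ_succ]
  simp [MeasurableEquiv.piFinSuccAbove, Fin.insertNthEquiv]

lemma A_succ {θ : ℝ} {h : ℝ → ℝ} (hh : G θ h) (n : ℕ) :
    A θ (n + 1) h = J θ (A θ n h) := by
  funext s
  unfold A J
  rw [integral_succ n (fun x => h (s - θ * x)), integral_prod _ (prod_int hh n s)]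
  congr 1; funext w
  congr 1; funext v
  congr 1; ring

lemma A_zero {θ : ℝ} {h : ℝ → ℝ} : A θ 0 h = h := by
  funext s
  unfold A
  have : ∀ v : EuclideanSpace ℝ (Fin 0), ‖v‖ = 0 := fun v => by
    rw [Subsingleton.elim v 0, norm_zero]
  simp only [this]
  have h1 : (volume : Measure (EuclideanSpace ℝ (Fin 0))).real Set.univ = 1 := by
    have e1 := (EuclideanSpace.volume_preserving_symm_measurableEquiv_toLp (Fin 0))
    have := e1.measure_preimage_equiv Set.univ
    rw [Set.preimage_univ] at this
    rw [Measure.real, this, volume_pi, Measure.pi_univ]; simp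
  simp [h1]

lemma A_eq {θ : ℝ} {h : ℝ → ℝ} (hh : G θ h) (n : ℕ) : A θ n h = (J θ)^[n] h := by
  induction n with
  | zero => simp [A_zero]
  | succ n ih => rw [A_succ hh, ih, Function.iterate_succ_apply']

lemma G.loc {θ : ℝ} (hθ : θ ≠ 0) {h : ℝ → ℝ} (hh : G θ h) (s₀ : ℝ) (N : ℕ) :
    ∃ C : ℝ, 0 ≤ C ∧ ∀ s ∈ Metric.ball s₀ 1, ∀ y : ℝ, 0 ≤ y →
      |h (s - θ * y)| ≤ C * ((1 + y) ^ N)⁻¹ := by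
  obtain ⟨C, hC, hb⟩ := hh.2 (s₀ + θ * (1 / |θ|)) N
  refine ⟨C, hC, fun s hs y hy => ?_⟩
  rw [Metric.mem_ball, Real.dist_eq] at hs
  have h1 : (s₀ + θ * (1 / |θ|)) - θ * ((1 / |θ| + (s₀ - s) / θ) + y) = s - θ * y := by
    field_simp; ring
  have h2 : 0 ≤ 1 / |θ| + (s₀ - s) / θ := by
    have : |(s₀ - s) / θ| ≤ 1 / |θ| := by
      rw [abs_div]; gcongr; rw [abs_sub_comm]; exact hs.le
    linarith [neg_abs_le ((s₀ - s) / θ)]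
  rw [← h1]
  refine (hb _ (by positivity)).trans ?_
  gcongr
  linarith

lemma G.J {θ : ℝ} (hθ : θ ≠ 0) {h : ℝ → ℝ} (hh : G θ h) : G θ (J θ h) := by
  have hc := hh.1
  constructor
  · rw [continuous_iff_continuousAt]
    intro s₀
    obtain ⟨C, hC, hb⟩ := hh.loc hθ s₀ 1
    refine continuousAt_of_dominated (μ := volume) (G := ℝ) (F := fun s (w : ℝ) => h (s - θ * w ^ 2))
      (bound := fun w => C * ((1 + w ^ 2) ^ 1)⁻¹) ?_ ?_
      (int1.const_mul C) ?_
    · exact Eventually.of_forall fun s => by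
        apply Continuous.aestronglyMeasurable; fun_prop
    · filter_upwards [Metric.ball_mem_nhds s₀ one_pos] with s hs
      exact ae_of_all _ fun w => hb s hs _ (by positivity)
    · exact ae_of_all _ fun w => Continuous.continuousAt (by fun_prop)
  · intro s N
    obtain ⟨C, hC, hb⟩ := hh.2 s (N + 1)
    refine ⟨∫ w : ℝ, C * ((1 + w ^ 2) ^ 1)⁻¹, integral_nonneg (μ := volume) (fun w : ℝ => by
      have : 0 ≤ C * ((1 + w ^ 2) ^ 1)⁻¹ := by positivity
      exact this),
      fun y hy => ?_⟩
    rw [← integral_mul_const]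
    unfold Parab.J
    rw [← Real.norm_eq_abs]
    refine norm_integral_le_of_norm_le (f := fun w : ℝ => h (s - θ * y - θ * w ^ 2)) ((int1.const_mul C).mul_const _) (ae_of_all _ fun w => ?_)
    have := hb (y + w ^ 2) (by positivity)
    rw [Real.norm_eq_abs]
    have e : s - θ * y - θ * w ^ 2 = s - θ * (y + w ^ 2) := by ring
    rw [e]
    refine this.trans ?_
    rw [mul_assoc]
    gcongr
    rw [mul_comm (((1 + w ^ 2) ^ 1)⁻¹)]
    exact inv_split _ _ hy (by positivity) _ _

lemma J_deriv {θ : ℝ} (hθ : θ ≠ 0) {h h' : ℝ → ℝ} (hh : G θ h) (hh' : G θ h')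
    (hd : ∀ x, HasDerivAt h (h' x) x) (s₀ : ℝ) : HasDerivAt (J θ h) (J θ h' s₀) s₀ := by
  have hc := hh.1
  have hc' := hh'.1
  obtain ⟨C, hC, hb⟩ := hh'.loc hθ s₀ 1
  obtain ⟨C1, hC1, hb1⟩ := hh.2 s₀ 1
  refine (hasDerivAt_integral_of_dominated_loc_of_deriv_le
    (F := fun s w => h (s - θ * w ^ 2)) (F' := fun s w => h' (s - θ * w ^ 2))
    (bound := fun w => C * ((1 + w ^ 2) ^ 1)⁻¹)
    (Metric.ball_mem_nhds s₀ one_pos) ?_ ?_ ?_ ?_ (int1.const_mul C) ?_).2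
  · exact Eventually.of_forall fun s => by
        apply Continuous.aestronglyMeasurable; fun_prop
  · refine (int1.const_mul C1).mono' (by apply Continuous.aestronglyMeasurable; fun_prop)
      (ae_of_all _ fun w => hb1 _ (by positivity))
  · apply Continuous.aestronglyMeasurable; fun_prop
  · exact ae_of_all _ fun w s hs => hb s hs _ (by positivity)
  · exact ae_of_all _ fun w s hs => by
      simpa using (hd (s - θ * w ^ 2)).comp_sub_const s (θ * w ^ 2)

lemma JJ {θ : ℝ} (hθ : θ ≠ 0) {h h' : ℝ → ℝ} (hh : G θ h) (hh' : G θ h')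
    (hd : ∀ x, HasDerivAt h (h' x) x) : J θ (J θ h') = fun s => (Real.pi / θ) * h s := by
  funext s
  have hc' := hh'.1
  have e1 : J θ (J θ h') s =
      ∫ z : ℝ × ℝ, h' (s - θ * (z.1 ^ 2 + z.2 ^ 2)) := by
    rw [Measure.volume_eq_prod, integral_prod _ (prod_int1 hh' s)]
    unfold J
    congr 1; funext w
    congr 1; funext v
    congr 1; ring
  have e2 : ∫ r in Set.Ioi (0:ℝ), r * h' (s - θ * r ^ 2) = (1 / (2 * θ)) * h s := by
    have := integral_Ioi_of_hasDerivAt_of_tendsto' (a := 0) (m := 0)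
      (f := fun r => -(1 / (2 * θ)) * h (s - θ * r ^ 2))
      (f' := fun r => r * h' (s - θ * r ^ 2)) ?_ ?_ ?_
    · rw [this]; simp
    · intro r _
      have h1 : HasDerivAt (fun r : ℝ => s - θ * r ^ 2) (-(θ * (2 * r))) r := by
        simpa using ((hasDerivAt_pow 2 r).const_mul θ).const_sub s
      have := ((hd (s - θ * r ^ 2)).comp r h1).const_mul (-(1 / (2 * θ)))
      refine this.congr_deriv ?_
      field_simp
    · obtain ⟨C, hC, hb⟩ := hh'.2 s 2
      refine ((int1.const_mul C).integrableOn).mono'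
        (by apply Continuous.aestronglyMeasurable; fun_prop)
        (ae_of_all _ fun r => ?_)
      rw [norm_mul, Real.norm_eq_abs, Real.norm_eq_abs]
      have h2 : |r| ≤ 1 + r ^ 2 := by nlinarith [sq_abs r, sq_nonneg (|r| - 1)]
      calc |r| * |h' (s - θ * r ^ 2)| ≤ (1 + r ^ 2) * (C * ((1 + r ^ 2) ^ 2)⁻¹) := by
            gcongr; exact hb _ (by positivity)
        _ = C * ((1 + r ^ 2) ^ 1)⁻¹ := by
            have : 1 + r ^ 2 ≠ 0 := by positivity
            field_simp
    · rw [← mul_zero (-(1 / (2 * θ)))]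
      refine Tendsto.const_mul _ ?_
      obtain ⟨C, hC, hb⟩ := hh.2 s 1
      refine squeeze_zero_norm (a := fun r : ℝ => C * ((1 + r ^ 2) ^ 1)⁻¹)
        (fun r => hb _ (by positivity)) ?_
      rw [← mul_zero C]
      refine Tendsto.const_mul _ (tendsto_inv_atTop_zero.comp ?_)
      simp only [pow_one]
      exact tendsto_atTop_add_const_left _ _ (tendsto_pow_atTop two_ne_zero)
  rw [e1, ← integral_comp_polarCoord_symm, polarCoord_target]
  have e3 : ∀ q : ℝ × ℝ, q.1 • h' (s - θ * ((polarCoord.symm q).1 ^ 2 + (polarCoord.symm q).2 ^ 2))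
      = (q.1 * h' (s - θ * q.1 ^ 2)) * (1 : ℝ) := by
    intro q
    rw [polarCoord_symm_apply]
    have : (q.1 * Real.cos q.2) ^ 2 + (q.1 * Real.sin q.2) ^ 2 = q.1 ^ 2 := by
      have := Real.cos_sq_add_sin_sq q.2
      linear_combination q.1 ^ 2 * this
    simp [this]
  simp only [e3]
  rw [Measure.volume_eq_prod, setIntegral_prod_mul (fun r => r * h' (s - θ * r ^ 2))
    (fun _ => (1 : ℝ)), e2]
  simp [Measure.real]
  rw [ENNReal.toReal_ofReal (by positivity)]
  field_simp
  ring

def Tower (θ : ℝ) (f : ℕ → ℝ → ℝ) : Prop :=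
  (∀ k, G θ (f k)) ∧ ∀ k x, HasDerivAt (f k) (f (k + 1) x) x

lemma Tower.J {θ : ℝ} (hθ : θ ≠ 0) {f : ℕ → ℝ → ℝ} (hf : Tower θ f) :
    Tower θ (fun k => J θ (f k)) :=
  ⟨fun k => (hf.1 k).J hθ, fun k x => J_deriv hθ (hf.1 k) (hf.1 (k + 1)) (hf.2 k) x⟩

lemma Tower.iter {θ : ℝ} (hθ : θ ≠ 0) {f : ℕ → ℝ → ℝ} (hf : Tower θ f) (n : ℕ) :
    Tower θ (fun k => (Parab.J θ)^[n] (f k)) := by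
  induction n with
  | zero => simpa using hf
  | succ n ih =>
    simp only [Function.iterate_succ_apply']
    exact ih.J hθ

lemma Tower.iteratedDeriv {θ : ℝ} {f : ℕ → ℝ → ℝ} (hf : Tower θ f) (n : ℕ) :
    iteratedDeriv n (f 0) = f n := by
  induction n with
  | zero => simp
  | succ n ih =>
    rw [iteratedDeriv_succ, ih]
    funext x
    exact (hf.2 n x).deriv

lemma J_const {θ c : ℝ} {h : ℝ → ℝ} : J θ (fun s => c * h s) = fun s => c * J θ h s := by
  funext s; unfold J; rw [integral_const_mul]

lemma J_iter_const {θ c : ℝ} {h : ℝ → ℝ} (n : ℕ) :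
    (J θ)^[n] (fun s => c * h s) = fun s => c * (J θ)^[n] h s := by
  induction n with
  | zero => simp
  | succ n ih => simp only [Function.iterate_succ_apply', ih, J_const]

lemma Tower.even {θ : ℝ} (hθ : θ ≠ 0) {f : ℕ → ℝ → ℝ} (hf : Tower θ f) (m k : ℕ) :
    (Parab.J θ)^[2 * m] (f (k + m)) = fun s => (Real.pi / θ) ^ m * f k s := by
  induction m with
  | zero => simp
  | succ m ih =>
    rw [show 2 * (m + 1) = 2 * m + 1 + 1 by ring, Function.iterate_succ_apply,
      Function.iterate_succ_apply, show k + (m + 1) = (k + m) + 1 by ring,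
      JJ hθ (hf.1 (k + m)) (hf.1 (k + m + 1)) (hf.2 (k + m)), J_iter_const, ih]
    funext s; ring

end Parab
namespace Parab

noncomputable def q (ε x : ℝ) : ℝ := if ε < |x| then x⁻¹ else 0

noncomputable def K (ε θ a : ℝ) : ℝ := ∫ w : ℝ, q ε (a - θ * w ^ 2)

lemma q_meas (ε : ℝ) : Measurable (q ε) := by
  unfold q
  exact Measurable.ite (measurableSet_lt measurable_const measurable_norm) measurable_inv
    measurable_const

lemma q_neg (ε x : ℝ) : q ε (-x) = - q ε x := by
  unfold q
  rw [abs_neg]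
  split_ifs <;> simp [inv_neg]

lemma q_bound {ε θ : ℝ} (hε : 0 < ε) (hθ : θ ≠ 0) : ∃ M : ℝ, 0 ≤ M ∧ ∀ a w : ℝ,
    |q ε (a - θ * w ^ 2)| ≤ M * (1 + |a|) * ((1 + w ^ 2) ^ 1)⁻¹ := by
  have ht : 0 < |θ| := abs_pos.mpr hθ
  refine ⟨1 / ε + 1 / (ε * |θ|) + 1 / |θ|, by positivity, fun a w => ?_⟩
  unfold q
  split_ifs with h
  · set x := a - θ * w ^ 2 with hx
    have hx0 : 0 < |x| := hε.trans h
    rw [abs_inv, pow_one, ← div_eq_mul_inv, inv_eq_one_div, div_le_div_iff₀ hx0 (by positivity)]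
    have h1 : |θ| * w ^ 2 ≤ |a| + |x| := by
      have : |θ| * w ^ 2 = |θ * w ^ 2| := by rw [abs_mul, abs_of_nonneg (sq_nonneg w)]
      rw [this, show θ * w ^ 2 = a - x by rw [hx]; ring]
      exact abs_sub _ _
    have h2 : 1 ≤ |x| / ε := by rw [le_div_iff₀ hε]; linarith
    have h3 : w ^ 2 ≤ |a| / |θ| + |x| / |θ| := by
      rw [← add_div, le_div_iff₀ ht]; linarith
    have h4 : |a| / |θ| ≤ |a| / |θ| * (|x| / ε) := le_mul_of_one_le_right (by positivity) h2
    have h5 : 0 ≤ |a| * |x| / ε + |x| / (ε * |θ|) + |a| * |x| / |θ| := by positivity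
    have h6 : (1 / ε + 1 / (ε * |θ|) + 1 / |θ|) * (1 + |a|) * |x| =
      |x| / ε + |a| / |θ| * (|x| / ε) + |x| / |θ| +
        (|a| * |x| / ε + |x| / (ε * |θ|) + |a| * |x| / |θ|) := by
      field_simp; ring
    rw [h6]; linarith
  · rw [abs_zero]; positivity

lemma q_int {ε θ : ℝ} (hε : 0 < ε) (hθ : θ ≠ 0) (a : ℝ) :
    Integrable (fun w : ℝ => q ε (a - θ * w ^ 2)) := by
  obtain ⟨M, hM, hb⟩ := q_bound hε hθ
  refine (int1.const_mul (M * (1 + |a|))).mono' ?_ (ae_of_all _ fun w => hb a w)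
  exact ((q_meas ε).comp (by fun_prop)).aestronglyMeasurable

noncomputable def P (b w : ℝ) : ℝ := (Real.log (w + b) - Real.log (w - b)) / (2 * b)

lemma P_deriv {b w : ℝ} (hb : 0 < b) (h0 : 0 ≤ w) (h : w ≠ b) :
    HasDerivAt (P b) ((b ^ 2 - w ^ 2)⁻¹) w := by
  have h1 : w + b ≠ 0 := by positivity
  have h2 : w - b ≠ 0 := sub_ne_zero.mpr h
  have h3 : b ^ 2 - w ^ 2 ≠ 0 := by
    rw [show b ^ 2 - w ^ 2 = -((w + b) * (w - b)) by ring]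
    exact neg_ne_zero.mpr (mul_ne_zero h1 h2)
  have d1 : HasDerivAt (fun w => Real.log (w + b)) (1 / (w + b)) w :=
    ((hasDerivAt_id w).add_const b).log h1
  have d2 : HasDerivAt (fun w => Real.log (w - b)) (1 / (w - b)) w :=
    ((hasDerivAt_id w).sub_const b).log h2
  refine ((d1.sub d2).div_const (2 * b)).congr_deriv ?_
  rw [show b ^ 2 - w ^ 2 = -((w + b) * (w - b)) by ring]
  field_simp
  ring

lemma P_zero (b : ℝ) : P b 0 = 0 := by
  unfold P
  rw [zero_add, zero_sub, Real.log_neg_eq_log, sub_self, zero_div]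

lemma P_top {b : ℝ} : Tendsto (P b) atTop (nhds 0) := by
  have h1 : Tendsto (fun w : ℝ => Real.log (1 + 2 * b * (w - b)⁻¹) / (2 * b)) atTop (nhds 0) := by
    have : Tendsto (fun w : ℝ => 1 + 2 * b * (w - b)⁻¹) atTop (nhds 1) := by
      have h2 : Tendsto (fun w : ℝ => w - b) atTop atTop :=
        tendsto_atTop_add_const_right _ _ tendsto_id
      simpa using ((tendsto_inv_atTop_zero.comp h2).const_mul (2 * b)).const_add 1
    have h3 := ((Real.continuousAt_log one_ne_zero).tendsto.comp this).div_const (2 * b)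
    simpa using h3
  refine h1.congr' ?_
  filter_upwards [eventually_gt_atTop b, eventually_gt_atTop (-b)] with w hw hw'
  have h2 : w - b ≠ 0 := by linarith
  have h3 : w + b ≠ 0 := by linarith
  unfold P
  rw [← Real.log_div h3 h2]
  congr 2
  field_simp
  ring

lemma K_formula {ε b : ℝ} (hε : 0 < ε) (hb : 0 < b) :
    K ε 1 (b ^ 2) = 2 * (P b √(b ^ 2 - ε) - P b √(b ^ 2 + ε)) := by
  set α := √(b ^ 2 - ε) with hα
  set β := √(b ^ 2 + ε) with hβ
  have hα0 : 0 ≤ α := Real.sqrt_nonneg _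
  have hβ2 : β ^ 2 = b ^ 2 + ε := Real.sq_sqrt (by positivity)
  have hβ0 : 0 ≤ β := Real.sqrt_nonneg _
  have hαb : α < b := by
    rw [hα, Real.sqrt_lt' hb]; linarith
  have hbβ : b < β := by
    apply lt_of_pow_lt_pow_left₀ 2 hβ0; linarith
  have hαge : b ^ 2 - ε ≤ α ^ 2 := by
    rcases le_total 0 (b ^ 2 - ε) with h | h
    · rw [hα, Real.sq_sqrt h]
    · exact h.trans (sq_nonneg _)
  set f : ℝ → ℝ := fun w => q ε (b ^ 2 - 1 * w ^ 2) with hf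
  have fi : Integrable f := q_int hε one_ne_zero (b ^ 2)
  have e0 : K ε 1 (b ^ 2) = 2 * ∫ w in Set.Ioi (0:ℝ), f w := by
    rw [← integral_comp_abs]
    simp only [hf, sq_abs]
    rfl
  have e1 : ∫ w in (0:ℝ)..α, f w = P b α := by
    have : ∫ w in (0:ℝ)..α, f w = ∫ w in (0:ℝ)..α, (b ^ 2 - w ^ 2)⁻¹ := by
      apply intervalIntegral.integral_congr_ae
      have hne : ∀ᵐ x : ℝ, x ≠ α := by simp [ae_iff]
      filter_upwards [hne] with x hx hmem
      rw [Set.uIoc_of_le hα0] at hmem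
      have hxα : x < α := lt_of_le_of_ne hmem.2 hx
      have hpos : 0 < b ^ 2 - ε := by
        by_contra hcon
        rw [hα, Real.sqrt_eq_zero_of_nonpos (not_lt.mp hcon)] at hxα
        linarith [hmem.1]
      have hα2 : α ^ 2 = b ^ 2 - ε := Real.sq_sqrt hpos.le
      have : x ^ 2 < α ^ 2 := by nlinarith [hmem.1]
      have h3 : ε < |b ^ 2 - 1 * x ^ 2| := lt_of_lt_of_le (by linarith) (le_abs_self _)
      simp only [hf, q, if_pos h3]
      rw [one_mul]
    rw [this, intervalIntegral.integral_eq_sub_of_hasDerivAt (f := P b), P_zero, sub_zero]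
    · intro x hx
      rw [Set.uIcc_of_le hα0] at hx
      exact P_deriv hb hx.1 (by linarith [hx.2])
    · apply ContinuousOn.intervalIntegrable
      apply ContinuousOn.inv₀ (by fun_prop)
      intro x hx
      rw [Set.uIcc_of_le hα0] at hx
      have : x ^ 2 < b ^ 2 := by nlinarith [hx.1, hx.2]
      linarith
  have e2 : ∫ w in α..β, f w = 0 := by
    apply intervalIntegral.integral_zero_ae
    refine ae_of_all _ fun x hx => ?_
    rw [Set.uIoc_of_le (by linarith)] at hx
    have h1 : x ^ 2 ≤ β ^ 2 := by nlinarith [hx.1, hx.2]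
    have h2 : α ^ 2 ≤ x ^ 2 := by nlinarith [hx.1, hx.2]
    have h3 : ¬ ε < |b ^ 2 - 1 * x ^ 2| := by
      rw [not_lt, abs_le]; constructor <;> linarith
    simp only [hf, q, if_neg h3]
  have e3 : ∫ w in Set.Ioi β, f w = 0 - P b β := by
    have hcongr : ∀ x ∈ Set.Ioi β, f x = (b ^ 2 - x ^ 2)⁻¹ := by
      intro x hx
      rw [Set.mem_Ioi] at hx
      have h1 : β ^ 2 < x ^ 2 := by nlinarith
      have h3 : ε < |b ^ 2 - 1 * x ^ 2| := lt_of_lt_of_le (by linarith) (neg_le_abs _)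
      simp only [hf, q, if_pos h3]
      rw [one_mul]
    rw [setIntegral_congr_fun measurableSet_Ioi hcongr]
    refine integral_Ioi_of_hasDerivAt_of_tendsto' (fun x hx => ?_)
      ((integrableOn_congr_fun hcongr measurableSet_Ioi).mp fi.integrableOn) P_top
    rw [Set.mem_Ici] at hx
    exact P_deriv hb (by linarith) (by linarith)
  rw [e0, ← intervalIntegral.integral_interval_add_Ioi (a := 0) (b := α) fi.integrableOn
    fi.integrableOn, ← intervalIntegral.integral_interval_add_Ioi (a := α) (b := β)
    fi.integrableOn fi.integrableOn, e1, e2, e3]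
  ring

lemma P_beta {ε b : ℝ} (hε : 0 < ε) (hb : 0 < b) :
    P b √(b ^ 2 + ε) = (2 * Real.log (b + √(b ^ 2 + ε)) - Real.log ε) / (2 * b) := by
  set β := √(b ^ 2 + ε) with hβ
  have hβ2 : β ^ 2 = b ^ 2 + ε := Real.sq_sqrt (by positivity)
  have hβ0 : 0 ≤ β := Real.sqrt_nonneg _
  unfold P
  have h1 : β - b = ε / (β + b) := by
    rw [eq_div_iff (by positivity)]; linarith
  rw [h1, Real.log_div hε.ne' (by positivity), add_comm b β]
  ring

lemma P_alpha {ε b : ℝ} (hε : 0 < ε) (hb : 0 < b) (h : ε ≤ b ^ 2) :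
    P b √(b ^ 2 - ε) = (2 * Real.log (b + √(b ^ 2 - ε)) - Real.log ε) / (2 * b) := by
  set β := √(b ^ 2 - ε) with hβ
  have hβ2 : β ^ 2 = b ^ 2 - ε := Real.sq_sqrt (by linarith)
  have hβ0 : 0 ≤ β := Real.sqrt_nonneg _
  unfold P
  have h1 : β - b = -(ε / (β + b)) := by
    rw [← neg_div, eq_div_iff (by positivity)]; linarith
  rw [h1, Real.log_neg_eq_log, Real.log_div hε.ne' (by positivity), add_comm b β]
  ring

lemma K_formula' {ε b : ℝ} (hε : 0 < ε) (hb : 0 < b) (h : ε ≤ b ^ 2) :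
    K ε 1 (b ^ 2) = 2 / b * (Real.log (b + √(b ^ 2 - ε)) - Real.log (b + √(b ^ 2 + ε))) := by
  rw [K_formula hε hb, P_alpha hε hb h, P_beta hε hb]
  field_simp
  ring

lemma K_bound_pos {ε b : ℝ} (hε : 0 < ε) (hb : 0 < b) :
    |K ε 1 (b ^ 2)| ≤ 2 * Real.log 3 / b := by
  set β := √(b ^ 2 + ε) with hβ
  have hβ2 : β ^ 2 = b ^ 2 + ε := Real.sq_sqrt (by positivity)
  have hβ0 : 0 ≤ β := Real.sqrt_nonneg _
  rcases le_total ε (b ^ 2) with h | h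
  · rw [K_formula' hε hb h, ← hβ]
    set α := √(b ^ 2 - ε) with hα
    have hα2 : α ^ 2 = b ^ 2 - ε := Real.sq_sqrt (by linarith)
    have hα0 : 0 ≤ α := Real.sqrt_nonneg _
    have hβb : β ≤ 2 * b := by
      apply le_of_sq_le_sq _ (by positivity) 
      nlinarith
    have hαβ : α ≤ β := by
      apply le_of_sq_le_sq _ (by positivity) 
      nlinarith
    have l1 : Real.log (b + α) ≤ Real.log (b + β) := Real.log_le_log (by positivity) (by linarith)
    have l2 : Real.log (b + β) ≤ Real.log 3 + Real.log (b + α) := by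
      rw [← Real.log_mul (by norm_num) (by positivity)]
      exact Real.log_le_log (by positivity) (by linarith)
    rw [abs_mul, abs_of_nonneg (by positivity : 0 ≤ 2 / b), abs_of_nonpos (by linarith),
      mul_div_right_comm]
    gcongr
    linarith
  · rw [K_formula hε hb, Real.sqrt_eq_zero_of_nonpos (by linarith : b ^ 2 - ε ≤ 0), P_zero, ← hβ]
    unfold P
    have hbβ : 5 / 4 * b ≤ β := by
      apply le_of_sq_le_sq _ (by positivity) 
      nlinarith
    have l1 : Real.log (β - b) ≤ Real.log (β + b) := Real.log_le_log (by linarith) (by linarith)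
    have l2 : Real.log (β + b) ≤ Real.log 3 + (Real.log 3 + Real.log (β - b)) := by
      rw [← Real.log_mul (by norm_num) (by linarith), ← Real.log_mul (by norm_num) (by linarith)]
      exact Real.log_le_log (by positivity) (by linarith)
    have l3 : 2 * (0 - (Real.log (β + b) - Real.log (β - b)) / (2 * b)) =
      - ((Real.log (β + b) - Real.log (β - b)) / b) := by field_simp; ring
    rw [l3, abs_neg, abs_of_nonneg (div_nonneg (by linarith) hb.le)]
    gcongr
    linarith

lemma integral_inv_sq {b : ℝ} (hb : 0 < b) :
    Integrable (fun w : ℝ => (b ^ 2 + w ^ 2)⁻¹) ∧ ∫ w : ℝ, (b ^ 2 + w ^ 2)⁻¹ = Real.pi / b := by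
  have e : (fun w : ℝ => (b ^ 2 + w ^ 2)⁻¹) = fun w => (b ^ 2)⁻¹ * (1 + (w / b) ^ 2)⁻¹ := by
    funext w
    rw [← mul_inv]; congr 1; field_simp
  rw [e]
  constructor
  · exact (integrable_inv_one_add_sq.comp_div hb.ne').const_mul _
  · rw [integral_const_mul, Measure.integral_comp_div (fun w : ℝ => (1 + w ^ 2)⁻¹) b,
      integral_univ_inv_one_add_sq, abs_of_pos hb, smul_eq_mul]
    field_simp

lemma K_bound_neg {ε b : ℝ} (hb : 0 < b) :
    |K ε 1 (-b ^ 2)| ≤ Real.pi / b := by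
  rw [← (integral_inv_sq hb).2, ← Real.norm_eq_abs]
  unfold K
  refine norm_integral_le_of_norm_le (integral_inv_sq hb).1 (ae_of_all _ fun w => ?_)
  unfold q
  split_ifs
  · rw [Real.norm_eq_abs, abs_inv, show -b ^ 2 - 1 * w ^ 2 = -(b ^ 2 + w ^ 2) by ring, abs_neg,
      abs_of_pos (by positivity)]
  · rw [norm_zero]; positivity

lemma K_neg {ε b : ℝ} (hb : 0 < b) (h : ε < b ^ 2) : K ε 1 (-b ^ 2) = - (Real.pi / b) := by
  rw [← (integral_inv_sq hb).2, ← integral_neg]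
  unfold K
  congr 1; funext w
  unfold q
  have e : -b ^ 2 - 1 * w ^ 2 = -(b ^ 2 + w ^ 2) := by ring
  rw [e, abs_neg, abs_of_pos (by positivity : 0 < b ^ 2 + w ^ 2), if_pos (by nlinarith), inv_neg]

lemma K1_bound {ε a : ℝ} (hε : 0 < ε) (ha : a ≠ 0) :
    |K ε 1 a| ≤ (2 * Real.log 3 + Real.pi) * (√|a|)⁻¹ := by
  have hl : 0 ≤ Real.log 3 := Real.log_nonneg (by norm_num)
  have hp := Real.pi_pos
  have hb : 0 < √|a| := Real.sqrt_pos.mpr (abs_pos.mpr ha)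
  have hb2 : √|a| ^ 2 = |a| := Real.sq_sqrt (abs_nonneg a)
  rcases lt_or_gt_of_ne ha with h | h
  · have := K_bound_neg (ε := ε) hb
    rw [hb2, abs_of_neg h, neg_neg] at this
    rw [abs_of_neg h]
    rw [abs_of_neg h] at hb
    refine this.trans ?_
    rw [div_eq_mul_inv]
    gcongr
    linarith
  · have := K_bound_pos hε hb
    rw [hb2, abs_of_pos h] at this
    rw [abs_of_pos h]
    rw [abs_of_pos h] at hb
    refine this.trans ?_
    rw [div_eq_mul_inv]
    gcongr
    linarith

lemma K1_lim_pos {a : ℝ} (ha : 0 < a) :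
    Tendsto (fun ε => K ε 1 a) (nhdsWithin 0 (Set.Ioi 0)) (nhds 0) := by
  have hb : 0 < √a := Real.sqrt_pos.mpr ha
  have hb2 : √a ^ 2 = a := Real.sq_sqrt ha.le
  set b := √a
  have h1 : Tendsto (fun ε => 2 / b * (Real.log (b + √(b ^ 2 - ε)) - Real.log (b + √(b ^ 2 + ε))))
      (nhds 0) (nhds 0) := by
    have hc : ContinuousAt (fun ε =>
        2 / b * (Real.log (b + √(b ^ 2 - ε)) - Real.log (b + √(b ^ 2 + ε)))) 0 := by
      refine ContinuousAt.mul continuousAt_const (ContinuousAt.sub ?_ ?_)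
      · exact ContinuousAt.log (by fun_prop) (by positivity)
      · exact ContinuousAt.log (by fun_prop) (by positivity)
    simpa [ContinuousAt] using hc
  refine (h1.mono_left nhdsWithin_le_nhds).congr' ?_
  filter_upwards [Ioo_mem_nhdsGT ha] with ε hε
  rw [← K_formula' hε.1 hb (by rw [hb2]; exact hε.2.le), hb2]

lemma K1_lim_neg {a : ℝ} (ha : a < 0) :
    Tendsto (fun ε => K ε 1 a) (nhdsWithin 0 (Set.Ioi 0)) (nhds (-(Real.pi / √|a|))) := by
  rw [abs_of_neg ha]
  have ha' : 0 < -a := by linarith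
  have hb : 0 < √(-a) := Real.sqrt_pos.mpr ha'
  have hb2 : √(-a) ^ 2 = -a := Real.sq_sqrt ha'.le
  refine tendsto_const_nhds.congr' ?_
  filter_upwards [Ioo_mem_nhdsGT ha'] with ε hε
  rw [← K_neg hb (by rw [hb2]; exact hε.2), hb2, neg_neg]

end Parab
namespace Parab

def S (g : ℝ → ℝ) : Prop :=
  Continuous g ∧ ∀ N : ℕ, ∃ C : ℝ, 0 ≤ C ∧ ∀ x, |g x| ≤ C * ((1 + |x|) ^ N)⁻¹

lemma S.G {g : ℝ → ℝ} (hg : S g) {θ : ℝ} (hθ : θ ≠ 0) : G θ g := by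
  refine ⟨hg.1, fun s N => ?_⟩
  obtain ⟨C, hC, hb⟩ := hg.2 N
  have ht : 0 < |θ| := abs_pos.mpr hθ
  refine ⟨C * ((1 + 1 / |θ|) * (1 + |s|)) ^ N, by positivity, fun y hy => ?_⟩
  refine (hb _).trans ?_
  rw [mul_assoc]
  gcongr
  rw [← div_eq_mul_inv, inv_eq_one_div, div_le_div_iff₀ (by positivity) (by positivity), one_mul,
    ← mul_pow]
  gcongr
  have h1 : |θ| * y ≤ |s| + |s - θ * y| := by
    have : |θ| * y = |s - (s - θ * y)| := by
      rw [sub_sub_cancel, abs_mul, abs_of_nonneg hy]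
    rw [this]; exact abs_sub _ _
  have h2 : y ≤ (|s| + |s - θ * y|) / |θ| := by rw [le_div_iff₀ ht]; linarith
  have h3 : (1 + 1 / |θ|) * (1 + |s|) * (1 + |s - θ * y|) =
    1 + (|s| + |s - θ * y|) / |θ| + (|s| + |s - θ * y| + |s| * |s - θ * y| +
      1 / |θ| + |s| * |s - θ * y| / |θ|) := by field_simp; ring
  have h4 : 0 ≤ (|s| + |s - θ * y| + |s| * |s - θ * y| +
      1 / |θ| + |s| * |s - θ * y| / |θ|) := by positivity
  rw [h3]; linarith

lemma S.neg {g : ℝ → ℝ} (hg : S g) : S (fun x => g (-x)) := by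
  have := hg.1
  refine ⟨by fun_prop, fun N => ?_⟩
  obtain ⟨C, hC, hb⟩ := hg.2 N
  exact ⟨C, hC, fun x => by simpa using hb (-x)⟩

lemma S.shift {g : ℝ → ℝ} (hg : S g) (c : ℝ) : S (fun x => g (x + c)) := by
  have hc := hg.1
  refine ⟨by fun_prop, fun N => ?_⟩
  obtain ⟨C, hC, hb⟩ := hg.2 N
  refine ⟨C * (1 + |c|) ^ N, by positivity, fun x => (hb _).trans ?_⟩
  rw [mul_assoc]
  gcongr
  rw [← div_eq_mul_inv, inv_eq_one_div, div_le_div_iff₀ (by positivity) (by positivity), one_mul,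
    ← mul_pow]
  gcongr
  have h1 : |x| ≤ |x + c| + |c| := by
    have := abs_sub (x + c) c
    rwa [add_sub_cancel_right] at this
  nlinarith [abs_nonneg c, abs_nonneg (x + c), mul_nonneg (abs_nonneg c) (abs_nonneg (x + c))]

lemma K_meas (ε θ : ℝ) : StronglyMeasurable (K ε θ) := by
  unfold K
  apply StronglyMeasurable.integral_prod_right (f := fun a w : ℝ => q ε (a - θ * w ^ 2))
  apply Measurable.stronglyMeasurable
  exact (q_meas ε).comp (by fun_prop)

lemma K_pos {θ : ℝ} (hθ : 0 < θ) (ε a : ℝ) : K ε θ a = (√θ)⁻¹ * K ε 1 a := by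
  have h := Measure.integral_comp_mul_left (fun w : ℝ => q ε (a - 1 * w ^ 2)) (√θ)
  have h2 : 0 < √θ := Real.sqrt_pos.mpr hθ
  rw [abs_of_pos (inv_pos.mpr h2), smul_eq_mul] at h
  unfold K
  rw [← h]
  congr 1; funext w
  rw [mul_pow, Real.sq_sqrt hθ.le, one_mul]

lemma K_negθ (ε θ a : ℝ) : K ε θ a = - K ε (-θ) (-a) := by
  unfold K
  rw [← integral_neg]
  congr 1; funext w
  rw [← q_neg]; congr 1; ring

lemma sqrt_int : Integrable (fun x : ℝ => (√|x|)⁻¹ * (1 + |x|)⁻¹) := by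
  have h1 : IntegrableOn (fun x : ℝ => (√|x|)⁻¹ * (1 + |x|)⁻¹) (Set.Ioi 0) := by
    have := (integrableOn_Ioi_comp_rpow_iff' (fun y : ℝ => (1 + y ^ 2)⁻¹)
      (p := 1 / 2) (by norm_num)).mpr integrable_inv_one_add_sq.integrableOn
    refine (integrableOn_congr_fun (fun x hx => ?_) measurableSet_Ioi).mp this
    rw [Set.mem_Ioi] at hx
    rw [smul_eq_mul, ← Real.sqrt_eq_rpow, Real.sq_sqrt hx.le, abs_of_pos hx,
      show (1 / 2 - 1 : ℝ) = -(1 / 2) by norm_num, Real.rpow_neg hx.le, ← Real.sqrt_eq_rpow]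
  have int_Iic : IntegrableOn (fun x : ℝ => (√|x|)⁻¹ * (1 + |x|)⁻¹) (Set.Iic 0) := by
    rw [← Measure.map_neg_eq_self (volume : Measure ℝ)]
    let m : MeasurableEmbedding fun x : ℝ => -x := (Homeomorph.neg ℝ).measurableEmbedding
    rw [m.integrableOn_map_iff]
    simp_rw [Function.comp_def, abs_neg, Set.neg_preimage, Set.neg_Iic, neg_zero]
    exact Iff.mpr integrableOn_Ici_iff_integrableOn_Ioi h1
  rw [← integrableOn_univ, ← Set.Iic_union_Ioi (a := (0:ℝ))]
  exact int_Iic.union h1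

lemma J_half {θ : ℝ} (hθ : 0 < θ) (g : ℝ → ℝ) (p : ℝ) :
    ∫ x in Set.Ioi (0:ℝ), g (p + x) * ((√θ)⁻¹ * (√|x|)⁻¹) = J (-θ) g p := by
  have h2 : 0 < √θ := Real.sqrt_pos.mpr hθ
  have e1 : J (-θ) g p = 2 * ∫ w in Set.Ioi (0:ℝ), g (p + (√θ * w) ^ 2) := by
    rw [← integral_comp_abs (f := fun w => g (p + (√θ * w) ^ 2))]
    unfold J
    congr 1; funext w
    rw [mul_pow, Real.sq_sqrt hθ.le, sq_abs]; congr 1; ring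
  have e2 := integral_comp_mul_left_Ioi (fun w => g (p + w ^ 2)) 0 h2
  have e3 := integral_comp_rpow_Ioi_of_pos (g := fun w => g (p + w ^ 2)) (p := 1 / 2) (by norm_num)
  rw [e1, e2, mul_zero, ← e3, smul_eq_mul, ← integral_const_mul, ← integral_const_mul]
  refine setIntegral_congr_fun measurableSet_Ioi (fun x hx => ?_)
  rw [Set.mem_Ioi] at hx
  simp only [smul_eq_mul]
  rw [← Real.sqrt_eq_rpow, Real.sq_sqrt hx.le, abs_of_pos hx,
      show (1 / 2 - 1 : ℝ) = -(1 / 2) by norm_num, Real.rpow_neg hx.le, ← Real.sqrt_eq_rpow]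
  ring

lemma hilb_pos {θ : ℝ} (hθ : 0 < θ) {g : ℝ → ℝ} (hg : S g) (p : ℝ) :
    Tendsto (fun ε => ∫ s, g s * K ε θ (p - s)) (nhdsWithin 0 (Set.Ioi 0))
      (nhds (-Real.pi * J (-θ) g p)) := by
  have hc := hg.1
  have h2 : 0 < √θ := Real.sqrt_pos.mpr hθ
  have hl : 0 ≤ Real.log 3 := Real.log_nonneg (by norm_num)
  have hp := Real.pi_pos
  have e1 : ∀ ε, ∫ s, g s * K ε θ (p - s) = ∫ x, g (p - x) * ((√θ)⁻¹ * K ε 1 x) := by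
    intro ε
    rw [← integral_sub_left_eq_self _ volume p]
    congr 1; funext x
    rw [sub_sub_cancel, K_pos hθ]
  have e2 : -Real.pi * J (-θ) g p = ∫ x, (Set.Iic (0:ℝ)).indicator
      (fun x => g (p - x) * ((√θ)⁻¹ * (-(Real.pi / √|x|)))) x := by
    rw [integral_indicator measurableSet_Iic, ← neg_zero, ← integral_comp_neg_Ioi,
      ← J_half hθ, ← integral_const_mul]
    refine setIntegral_congr_fun measurableSet_Ioi (fun x hx => ?_)
    simp only [sub_neg_eq_add, abs_neg]
    ring
  rw [e2]
  simp only [e1]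
  obtain ⟨C, hC, hb⟩ := (hg.shift p).neg.2 1
  refine tendsto_integral_filter_of_dominated_convergence
    (fun x => (C * (√θ)⁻¹ * (2 * Real.log 3 + Real.pi)) * ((√|x|)⁻¹ * (1 + |x|)⁻¹)) ?_ ?_
    (sqrt_int.const_mul _) ?_
  · refine Eventually.of_forall fun ε => ?_
    exact ((by fun_prop : Continuous fun x => g (p - x)).aestronglyMeasurable).mul
      ((K_meas ε 1).aestronglyMeasurable.const_mul _)
  · filter_upwards [self_mem_nhdsWithin] with ε hε
    have hne : ∀ᵐ x : ℝ, x ≠ 0 := by simp [ae_iff]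
    filter_upwards [hne] with x hx
    rw [norm_mul, norm_mul, Real.norm_eq_abs, Real.norm_eq_abs, Real.norm_eq_abs,
      abs_of_pos (inv_pos.mpr h2)]
    have h3 : |g (p - x)| ≤ C * (1 + |x|)⁻¹ := by
      have := hb x
      change |g (-x + p)| ≤ _ at this
      rwa [pow_one, show -x + p = p - x by ring] at this
    calc |g (p - x)| * ((√θ)⁻¹ * |K ε 1 x|)
        ≤ (C * (1 + |x|)⁻¹) * ((√θ)⁻¹ * ((2 * Real.log 3 + Real.pi) * (√|x|)⁻¹)) := by
          gcongr
          exact K1_bound hε hx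
      _ = _ := by ring
  · have hne : ∀ᵐ x : ℝ, x ≠ 0 := by simp [ae_iff]
    filter_upwards [hne] with x hx
    rcases lt_or_gt_of_ne hx with h | h
    · rw [Set.indicator_of_mem (Set.mem_Iic.mpr h.le)]
      exact ((K1_lim_neg h).const_mul _).const_mul _
    · rw [Set.indicator_of_notMem (by simpa using h)]
      simpa using ((K1_lim_pos h).const_mul (√θ)⁻¹).const_mul (g (p - x))

lemma hilb_neg {θ : ℝ} (hθ : θ < 0) {g : ℝ → ℝ} (hg : S g) (p : ℝ) :
    Tendsto (fun ε => ∫ s, g s * K ε θ (p - s)) (nhdsWithin 0 (Set.Ioi 0))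
      (nhds (Real.pi * J (-θ) g p)) := by
  have h := (hilb_pos (neg_pos.mpr hθ) hg.neg (-p)).neg
  have e1 : -(-Real.pi * J (- -θ) (fun x => g (-x)) (-p)) = Real.pi * J (-θ) g p := by
    rw [neg_mul, neg_neg]
    congr 1
    unfold J
    congr 1; funext w
    change g (-(-p - - -θ * w ^ 2)) = g (p - -θ * w ^ 2)
    congr 1; ring
  rw [e1] at h
  refine h.congr fun ε => ?_
  rw [← integral_neg, ← integral_neg_eq_self]
  congr 1; funext s
  rw [neg_neg, K_negθ ε θ, neg_sub]
  rw [show -p - -s = s - p by ring]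
  ring

lemma fubini {θ ε : ℝ} (hθ : θ ≠ 0) (hε : 0 < ε) {g : ℝ → ℝ} (hg : S g) (p : ℝ) :
    ∫ t in {t : ℝ | ε < |p - t|}, J θ g t / (p - t) = ∫ s, g s * K ε θ (p - s) := by
  have hc := hg.1
  have hm := q_meas ε
  have hset : MeasurableSet {t : ℝ | ε < |p - t|} :=
    measurableSet_lt measurable_const (by fun_prop)
  have e0 : ∫ t in {t : ℝ | ε < |p - t|}, J θ g t / (p - t) =
      ∫ t, ∫ w, g (t - θ * w ^ 2) * q ε (p - t) := by
    rw [← integral_indicator hset]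
    congr 1; funext t
    rw [integral_mul_const]
    by_cases h : ε < |p - t|
    · rw [Set.indicator_of_mem (by exact h), q, if_pos h, div_eq_mul_inv]; rfl
    · rw [Set.indicator_of_notMem (by exact h), q, if_neg h, mul_zero]
  have i1 : Integrable (Function.uncurry fun w s : ℝ => g s * q ε (p - s - θ * w ^ 2))
      (volume.prod volume) := by
    obtain ⟨M, hM, hb⟩ := q_bound hε hθ
    obtain ⟨C, hC, hgb⟩ := hg.2 3
    have hbd : Integrable (fun s : ℝ => (M * C * (1 + |p|)) * ((1 + s ^ 2) ^ 1)⁻¹) :=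
      int1.const_mul _
    refine (int1.mul_prod hbd).mono' ?_ (ae_of_all _ fun z => ?_)
    · apply Measurable.aestronglyMeasurable
      exact (hc.measurable.comp measurable_snd).mul (hm.comp (by fun_prop))
    · obtain ⟨w, s⟩ := z
      simp only [Function.uncurry]
      rw [norm_mul, Real.norm_eq_abs, Real.norm_eq_abs]
      have h1 : 1 + |p - s| ≤ (1 + |p|) * (1 + |s|) := by
        nlinarith [abs_sub p s, mul_nonneg (abs_nonneg p) (abs_nonneg s)]
      have h2 : ((1 + |s|) ^ 2)⁻¹ ≤ ((1 + s ^ 2) ^ 1)⁻¹ := by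
        gcongr
        nlinarith [sq_abs s, abs_nonneg s]
      calc |g s| * |q ε (p - s - θ * w ^ 2)|
          ≤ (C * ((1 + |s|) ^ 3)⁻¹) *
            (M * ((1 + |p|) * (1 + |s|)) * ((1 + w ^ 2) ^ 1)⁻¹) := by
            gcongr
            · exact hgb s
            · refine (hb (p - s) w).trans ?_
              gcongr
        _ = ((1 + w ^ 2) ^ 1)⁻¹ * (M * C * (1 + |p|) * ((1 + |s|) ^ 2)⁻¹) := by
            have : 1 + |s| ≠ 0 := by positivity
            field_simp
        _ ≤ _ := by gcongr
  have i2 : Integrable (Function.uncurry fun w t : ℝ => g (t - θ * w ^ 2) * q ε (p - t))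
      (volume.prod volume) := by
    have mp : MeasurePreserving (fun z : ℝ × ℝ => (id z.1, z.2 - θ * z.1 ^ 2))
        (volume.prod volume) (volume.prod volume) := by
      refine (MeasurePreserving.id volume).skew_product (g := fun w t : ℝ => t - θ * w ^ 2)
        ?_ (ae_of_all _ fun w => ?_)
      · simp only [Function.uncurry_def]; fun_prop
      · exact (measurePreserving_sub_right volume (θ * w ^ 2)).map_eq
    have := (mp.integrable_comp i1.aestronglyMeasurable).mpr i1
    refine this.congr (ae_of_all _ fun z => ?_)
    simp only [Function.comp, Function.uncurry, id]
    congr 2; ring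
  rw [e0, ← integral_integral_swap i2]
  have e1 : ∀ w : ℝ, ∫ t, g (t - θ * w ^ 2) * q ε (p - t) =
      ∫ s, g s * q ε (p - s - θ * w ^ 2) := by
    intro w
    rw [← integral_sub_right_eq_self (fun s => g s * q ε (p - s - θ * w ^ 2)) (θ * w ^ 2)]
    congr 1; funext t; congr 2; ring
  simp only [e1]
  rw [integral_integral_swap i1]
  congr 1; funext s
  rw [integral_const_mul]; rfl

lemma hilb {θ : ℝ} (hθ : θ ≠ 0) {g : ℝ → ℝ} (hg : S g) (p : ℝ) :
    Tendsto (fun ε => ∫ t in {t : ℝ | ε < |p - t|}, J θ g t / (p - t))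
      (nhdsWithin 0 (Set.Ioi 0)) (nhds (-(|θ| / θ) * Real.pi * J (-θ) g p)) := by
  have h : Tendsto (fun ε => ∫ s, g s * K ε θ (p - s)) (nhdsWithin 0 (Set.Ioi 0))
      (nhds (-(|θ| / θ) * Real.pi * J (-θ) g p)) := by
    rcases lt_or_gt_of_ne hθ with h | h
    · rw [abs_of_neg h, neg_div, div_self hθ, neg_neg, one_mul]; exact hilb_neg h hg p
    · rw [abs_of_pos h, div_self hθ, neg_one_mul]; exact hilb_pos h hg p
  refine h.congr' ?_
  filter_upwards [self_mem_nhdsWithin] with ε hε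
  exact (fubini hθ hε hg p).symm

lemma core (n : ℕ) (θ : ℝ) (hθ : θ ≠ 0) (f : ℕ → ℝ → ℝ) (hS : ∀ k, S (f k))
    (hd : ∀ k x, HasDerivAt (f k) (f (k + 1) x) x) (Λ : ℝ → ℝ)
    (hΛodd : Odd n → ∀ p : ℝ,
      Tendsto (fun ε : ℝ =>
          (-1 : ℝ) ^ ((n - 1) / 2) * (1 / Real.pi) *
            ∫ t in {t : ℝ | ε < |p - t|}, (iteratedDeriv n (A θ n (f 0)) t) / (p - t))
        (nhdsWithin 0 (Set.Ioi 0)) (nhds (Λ p)))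
    (hΛeven : Even n → ∀ p : ℝ,
      Λ p = (-1 : ℝ) ^ (n / 2) * iteratedDeriv n (A θ n (f 0)) p) (p : ℝ) :
    f 0 p = (|θ| ^ n / Real.pi ^ n) * A (-θ) n Λ p := by
  have hθ' : -θ ≠ 0 := neg_ne_zero.mpr hθ
  have T1 : Tower θ f := ⟨fun k => (hS k).G hθ, hd⟩
  have T2 : Tower (-θ) f := ⟨fun k => (hS k).G hθ', hd⟩
  have hp := Real.pi_ne_zero
  have hD : iteratedDeriv n (A θ n (f 0)) = (J θ)^[n] (f n) := by
    rw [A_eq (T1.1 0)]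
    exact (T1.iter hθ n).iteratedDeriv n
  rw [hD] at hΛodd hΛeven
  have hA : ∀ (c : ℝ) (h : ℝ → ℝ), A (-θ) n (fun s => c * h s) p = c * A (-θ) n h p := by
    intro c h; unfold A; rw [integral_const_mul]
  rcases Nat.even_or_odd n with hn | hn
  · obtain ⟨m, hm⟩ := hn.two_dvd
    have hΛ : Λ = fun s => ((-1) ^ m * (Real.pi / θ) ^ m) * f m s := by
      funext s
      rw [hΛeven hn s, hm, show f (2 * m) = f (m + m) by rw [two_mul], T1.even hθ m m,
        Nat.mul_div_cancel_left _ two_pos]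
      ring
    have h2 := T2.even hθ' m 0
    rw [zero_add] at h2
    rw [hΛ, hA, A_eq (T2.1 m), hm, h2, pow_mul, sq_abs, pow_mul]
    have e : (-1 : ℝ) ^ m * (Real.pi / θ) ^ m * ((Real.pi / -θ) ^ m * f 0 p) =
        (Real.pi ^ 2 / θ ^ 2) ^ m * f 0 p := by
      rw [← mul_assoc, ← mul_pow, ← mul_pow]; congr 2; field_simp
    rw [e, ← div_pow, ← mul_assoc, ← mul_pow]
    have e2 : θ ^ 2 / Real.pi ^ 2 * (Real.pi ^ 2 / θ ^ 2) = 1 := by field_simp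
    rw [e2, one_pow, one_mul]
  · obtain ⟨m, hm⟩ := hn
    replace hm : n = 2 * m + 1 := hm
    have hJ : (J θ)^[n] (f n) = fun s => (Real.pi / θ) ^ m * J θ (f (m + 1)) s := by
      rw [hm, Function.iterate_succ_apply', show 2 * m + 1 = (m + 1) + m by ring,
        T1.even hθ m (m + 1), J_const]
    have hΛ : Λ = fun s => ((-1) ^ m * (Real.pi / θ) ^ m * (-(|θ| / θ))) * J (-θ) (f (m + 1)) s := by
      funext s
      refine tendsto_nhds_unique (hΛodd ⟨m, hm⟩ s) ?_
      rw [hJ, show (n - 1) / 2 = m by omega]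
      have := (hilb hθ (hS (m + 1)) s).const_mul ((-1) ^ m * (1 / Real.pi) * (Real.pi / θ) ^ m)
      convert this using 2
      · rename_i ε
        simp only [mul_div_assoc]
        rw [integral_const_mul]
        ring
      · field_simp
    have h2 := T2.even hθ' (m + 1) 0
    rw [zero_add, show 2 * (m + 1) = (2 * m + 1) + 1 by ring, Function.iterate_succ_apply] at h2
    rw [hΛ, hA, A_eq ((T2.1 (m + 1)).J hθ'), hm, h2]
    have e : (-1 : ℝ) ^ m * (Real.pi / θ) ^ m * (-(|θ| / θ)) *
        ((Real.pi / -θ) ^ (m + 1) * f 0 p) =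
        (Real.pi ^ 2 / θ ^ 2) ^ m * (|θ| * Real.pi / θ ^ 2) * f 0 p := by
      have : (-1 : ℝ) ^ m * (Real.pi / θ) ^ m * (Real.pi / -θ) ^ m = (Real.pi ^ 2 / θ ^ 2) ^ m := by
        rw [← mul_pow, ← mul_pow]; congr 1; field_simp
      rw [← this, pow_succ]
      field_simp
    rw [e, pow_succ, pow_succ, pow_mul, sq_abs, pow_mul]
    have e3 : θ ^ 2 / Real.pi ^ 2 * (Real.pi ^ 2 / θ ^ 2) = 1 := by field_simp
    have e4 : |θ| / Real.pi * (|θ| * Real.pi / θ ^ 2) = 1 := by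
      rw [← sq_abs θ]
      have : |θ| ≠ 0 := abs_ne_zero.mpr hθ
      field_simp
    calc f 0 p = (θ ^ 2 / Real.pi ^ 2 * (Real.pi ^ 2 / θ ^ 2)) ^ m *
          (|θ| / Real.pi * (|θ| * Real.pi / θ ^ 2)) * f 0 p := by
          rw [e3, e4, one_pow, one_mul, one_mul]
      _ = _ := by rw [mul_pow, div_pow (θ ^ 2)]; ring

lemma S_schwartz (φ : SchwartzMap ℝ ℝ) (k : ℕ) : S (iteratedDeriv k φ) := by
  refine ⟨(φ.smooth ⊤).continuous_iteratedDeriv k (by exact_mod_cast le_top), fun N => ?_⟩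
  have h := φ.one_add_le_sup_seminorm_apply (𝕜 := ℝ) (m := (N, k)) le_rfl le_rfl
  set C := 2 ^ (N, k).1 * ((Finset.Iic (N, k)).sup fun m => SchwartzMap.seminorm ℝ m.1 m.2) φ
  refine ⟨C, le_trans (by positivity) (h 0), fun x => ?_⟩
  · have := h x
    rw [norm_iteratedFDeriv_eq_norm_iteratedDeriv, Real.norm_eq_abs, Real.norm_eq_abs] at this
    rw [← div_eq_mul_inv, le_div_iff₀ (by positivity), mul_comm]
    exact this

end Parab

theorem stmt19 (n : ℕ) (hn : 1 ≤ n) (ω : EuclideanSpace ℝ (Fin n)) (θ : ℝ)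
    (hsph : ‖ω‖ ^ 2 + θ ^ 2 = 1) (hθ : θ ≠ 0)
    (φ : SchwartzMap ℝ ℝ) (Λ : ℝ → ℝ)
    (hΛodd : Odd n → ∀ p : ℝ,
      Tendsto (fun ε : ℝ =>
          (-1 : ℝ) ^ ((n - 1) / 2) * (1 / Real.pi) *
            ∫ t in {t : ℝ | ε < |p - t|},
              (iteratedDeriv n
                (fun s => ∫ u : EuclideanSpace ℝ (Fin n),
                  φ (s + ⟪ω, u⟫ - θ * ‖u‖ ^ 2)) t) / (p - t))
        (nhdsWithin 0 (Set.Ioi 0)) (nhds (Λ p)))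
    (hΛeven : Even n → ∀ p : ℝ,
      Λ p = (-1 : ℝ) ^ (n / 2) *
        iteratedDeriv n
          (fun s => ∫ u : EuclideanSpace ℝ (Fin n),
            φ (s + ⟪ω, u⟫ - θ * ‖u‖ ^ 2)) p)
    (p : ℝ) :
    φ p = (|θ| ^ n / Real.pi ^ n) *
      ∫ v : EuclideanSpace ℝ (Fin n), Λ (p + ⟪ω, v⟫ + θ * ‖v‖ ^ 2) := by
  set c : ℝ := ‖ω‖ ^ 2 / (4 * θ) with hc
  set f : ℕ → ℝ → ℝ := fun k x => iteratedDeriv k φ (x + c) with hf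
  have hS : ∀ k, Parab.S (f k) := fun k => (Parab.S_schwartz φ k).shift c
  have hd : ∀ k x, HasDerivAt (f k) (f (k + 1) x) x := by
    intro k x
    have h1 : Differentiable ℝ (iteratedDeriv k φ) :=
      (φ.smooth ⊤).differentiable_iteratedDeriv k (by exact_mod_cast WithTop.coe_lt_top _)
    have h2 := (h1 (x + c)).hasDerivAt.comp_add_const x c
    simp only [hf, iteratedDeriv_succ]
    exact h2
  have sq : ∀ (a : ℝ) (u : EuclideanSpace ℝ (Fin n)),
      ‖u + a • ω‖ ^ 2 = ‖u‖ ^ 2 + 2 * a * ⟪ω, u⟫ + a ^ 2 * ‖ω‖ ^ 2 := by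
    intro a u
    rw [norm_add_sq_real, inner_smul_right, norm_smul, mul_pow, Real.norm_eq_abs, sq_abs,
      real_inner_comm]
    ring
  have hF : (fun s => ∫ u : EuclideanSpace ℝ (Fin n), φ (s + ⟪ω, u⟫ - θ * ‖u‖ ^ 2)) =
      Parab.A θ n (f 0) := by
    funext s
    unfold Parab.A
    rw [← integral_add_right_eq_self _ ((1 / (2 * θ)) • ω)]
    congr 1; funext u
    simp only [hf, iteratedDeriv_zero, sq, inner_add_right, inner_smul_right,
      real_inner_self_eq_norm_sq]
    congr 1
    rw [hc]; field_simp; ring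
  rw [hF] at hΛodd hΛeven
  have key := Parab.core n θ hθ f hS hd Λ hΛodd hΛeven (p - c)
  have h0 : f 0 (p - c) = φ p := by simp [hf]
  rw [← h0, key]
  congr 1
  unfold Parab.A
  rw [← integral_add_right_eq_self _ ((1 / (2 * θ)) • ω)]
  congr 1; funext u
  simp only [sq]
  congr 1
  rw [hc]; field_simp; ring
end
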